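/- arXiv:2010.14118 — 12 statements merged into one kernel-verified Lean document; each statement's English description precedes it below -/
import Mathlib

section
/- Let G be a group and let D : U → G be a G-valued Dedekind symbol. Then its associated function F(p,q) = D(p,q)·D(-q,p)⁻¹ is a G-valued reciprocity function, i.e. for all (p,q) ∈ U it satisfies F(p,-q) = F(-p,q), F(p,q)·F(-q,p) = 1, and F(p,p+q)·F(p+q,q) = F(p,q). -/
/-- The function `F(p,q) = D(p,q)·D(-q,p)⁻¹` associated to a `G`-valued
Dedekind symbol `D` on `U = {(p,q) : gcd(p,q) = 1}` is a `G`-valued reciprocity function. -/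
theorem associated_function_is_reciprocity_function {G : Type*} [Group G]
    (D : ℤ → ℤ → G)
    (hD1 : ∀ p q : ℤ, Int.gcd p q = 1 → D p (-q) = D (-p) q)
    (hD2 : ∀ p q : ℤ, Int.gcd p q = 1 → D p q = D p (p + q)) :
    ∀ F : ℤ → ℤ → G, (∀ p q : ℤ, F p q = D p q * (D (-q) p)⁻¹) →
      (∀ p q : ℤ, Int.gcd p q = 1 → F p (-q) = F (-p) q) ∧
      (∀ p q : ℤ, Int.gcd p q = 1 → F p q * F (-q) p = 1) ∧
      (∀ p q : ℤ, Int.gcd p q = 1 → F p (p + q) * F (p + q) q = F p q) := by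
  intro F hF
  have neg_neg_eq (p q : ℤ) (h : Int.gcd p q = 1) : D (-p) (-q) = D p q := by
    simpa using hD1 (-p) q (by simpa using h)
  refine ⟨fun p q h => ?_, fun p q h => ?_, fun p q h => ?_⟩
  · rw [hF, hF, hD1 p q h, neg_neg_eq q p (by rwa [Int.gcd_comm]), neg_neg]
  · rw [hF, hF, neg_neg_eq p q h]
    group
  · have hsum : Int.gcd (p + q) q = 1 := by simpa using h
    have hleft : D (-(p + q)) p = D (p + q) q := by
      rw [hD2 (-(p + q)) p (by simpa [Int.gcd_comm] using h), ← neg_neg_eq (p + q) q hsum]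
      congr 1
      ring
    have hright : D (-q) (p + q) = D (-q) p := by
      rw [hD2 (-q) (p + q) (by rwa [Int.neg_gcd, Int.gcd_comm])]
      congr 1
      ring
    rw [hF, hF, hF, hleft, hright, ← hD2 p q h]
    group
end

section
/- (Fukuhara–Manin) Let G be a group. For any G-valued reciprocity function F : U → G there exists a G-valued Dedekind symbol D : U → G whose associated function equals F, i.e. D(p,q)·D(-q,p)⁻¹ = F(p,q) for all (p,q) ∈ U. -/
/-- The Dedekind symbol of `F` at a nonnegative first argument, computed by the Euclidean
algorithm. -/
def euclideanSymbol {G : Type*} [Group G] (F : ℤ → ℤ → G) : ℕ → ℤ → G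
  | 0, _ => 1
  | n + 1, q => F (n + 1) (q % (n + 1)) *
      euclideanSymbol F (q % (n + 1)).toNat (-(n + 1))
  termination_by n => n
  decreasing_by
    have := Int.emod_lt_of_pos q (show (0 : ℤ) < n + 1 by lia)
    lia

/-- The Dedekind symbol of `F`, extended to all integers so as to be invariant under
`(p, q) ↦ (-p, -q)`. -/
def dedekindSymbol {G : Type*} [Group G] (F : ℤ → ℤ → G) (p q : ℤ) : G :=
  euclideanSymbol F p.natAbs (p.sign * q)

section

variable {G : Type*} [Group G] (F : ℤ → ℤ → G)

theorem euclideanSymbol_add_mul (n : ℕ) (q k : ℤ) :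
    euclideanSymbol F n (q + n * k) = euclideanSymbol F n q := by
  cases n with
  | zero => simp [euclideanSymbol]
  | succ n =>
    rw [euclideanSymbol, euclideanSymbol]
    push_cast
    rw [Int.add_mul_emod_self_left]

theorem dedekindSymbol_neg_right (p q : ℤ) :
    dedekindSymbol F p (-q) = dedekindSymbol F (-p) q := by
  simp [dedekindSymbol]

theorem dedekindSymbol_add_self (p q : ℤ) :
    dedekindSymbol F p (p + q) = dedekindSymbol F p q := by
  rw [dedekindSymbol, dedekindSymbol, mul_add, Int.sign_mul_self_eq_natAbs, add_comm]
  simpa using euclideanSymbol_add_mul F p.natAbs (p.sign * q) 1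

theorem dedekindSymbol_of_lt {p q : ℤ} (hq : 0 ≤ q) (hqp : q < p) :
    dedekindSymbol F p q = F p q * dedekindSymbol F (-q) p := by
  obtain ⟨n, rfl⟩ : ∃ n : ℕ, p = n + 1 := ⟨(p - 1).toNat, by lia⟩
  have hn : ((n : ℤ) + 1).natAbs = n + 1 := by lia
  have hs : ((n : ℤ) + 1).sign = 1 := Int.sign_eq_one_of_pos (by lia)
  rw [dedekindSymbol, hn, hs, one_mul, euclideanSymbol, Int.emod_eq_of_lt hq hqp]
  rcases hq.eq_or_lt with rfl | hq
  · simp [dedekindSymbol, euclideanSymbol]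
  · rw [dedekindSymbol, Int.sign_neg, Int.sign_eq_one_of_pos hq, Int.natAbs_neg, neg_one_mul,
      show q.toNat = q.natAbs by lia]

variable {F}

theorem reciprocity_neg
    (hF1 : ∀ p q : ℤ, Int.gcd p q = 1 → F p (-q) = F (-p) q)
    {p q : ℤ} (hpq : Int.gcd p q = 1)
    (h : dedekindSymbol F p q = F p q * dedekindSymbol F (-q) p) :
    dedekindSymbol F (-p) (-q) = F (-p) (-q) * dedekindSymbol F (- -q) (-p) := by
  rw [← hF1 p (-q) (by simpa using hpq), ← dedekindSymbol_neg_right F p,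
    ← dedekindSymbol_neg_right F (-q), neg_neg, neg_neg, h]

theorem reciprocity_swap
    (hF2 : ∀ p q : ℤ, Int.gcd p q = 1 → F p q * F (-q) p = 1)
    {p q : ℤ} (hpq : Int.gcd p q = 1)
    (h : dedekindSymbol F p (-q) = F p (-q) * dedekindSymbol F q p) :
    dedekindSymbol F q p = F q p * dedekindSymbol F (-p) q := by
  have h2 := hF2 p (-q) (by simpa using hpq)
  rw [neg_neg] at h2
  rw [← dedekindSymbol_neg_right, h, ← mul_assoc, mul_eq_one_iff_eq_inv.mp h2, mul_inv_cancel,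
    one_mul]

theorem reciprocity_of_add
    (hF3 : ∀ p q : ℤ, Int.gcd p q = 1 → F p (p + q) * F (p + q) q = F p q)
    {p q : ℤ} (hpq : Int.gcd p q = 1)
    (h₁ : dedekindSymbol F p (p + q) = F p (p + q) * dedekindSymbol F (-(p + q)) p)
    (h₂ : dedekindSymbol F (p + q) q = F (p + q) q * dedekindSymbol F (-q) (p + q)) :
    dedekindSymbol F p q = F p q * dedekindSymbol F (-q) p := by
  have e₁ : dedekindSymbol F (-(p + q)) p = dedekindSymbol F (p + q) q := by
    rw [← dedekindSymbol_neg_right, ← dedekindSymbol_add_self F (p + q) (-p)]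
    congr 1
    ring
  have e₂ : dedekindSymbol F (-q) p = dedekindSymbol F (-q) (p + q) := by
    rw [← dedekindSymbol_add_self F (-q) (p + q)]
    congr 1
    ring
  rw [← hF3 p q hpq, e₂, mul_assoc, ← h₂, ← e₁, ← h₁, dedekindSymbol_add_self]

theorem reciprocity_of_pos_of_neg
    (hF1 : ∀ p q : ℤ, Int.gcd p q = 1 → F p (-q) = F (-p) q)
    (hF2 : ∀ p q : ℤ, Int.gcd p q = 1 → F p q * F (-q) p = 1)
    (hF3 : ∀ p q : ℤ, Int.gcd p q = 1 → F p (p + q) * F (p + q) q = F p q)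
    {p q : ℤ} (hp : 0 < p) (hq : q < 0) (hpq : Int.gcd p q = 1) :
    dedekindSymbol F p q = F p q * dedekindSymbol F (-q) p := by
  induction hn : p.natAbs using Nat.strong_induction_on generalizing p with
  | _ n ih =>
    rcases lt_trichotomy 0 (p + q) with h | h | h
    · exact reciprocity_of_add hF3 hpq (dedekindSymbol_of_lt F h.le (by lia))
        (ih _ (by lia) h (by simpa using hpq) rfl)
    · obtain rfl : q = -p := by lia
      obtain rfl : p = 1 := by
        rw [Int.gcd_neg, Int.gcd_self] at hpq
        lia
      have h₀ := dedekindSymbol_of_lt F le_rfl (zero_lt_one' ℤ)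
      have h₁ := reciprocity_neg hF1 (by simp) h₀
      refine reciprocity_of_add hF3 hpq (by simpa using h₀) ?_
      simpa using reciprocity_swap hF2 (p := -1) (q := 0) (by simp) (by simpa using h₁)
    · have h₁ := dedekindSymbol_of_lt F hp.le (show p < -q by lia)
      have hqp : Int.gcd q p = 1 := by rwa [Int.gcd_comm]
      have h₂ := reciprocity_neg hF1 (by simpa using hqp) h₁
      exact reciprocity_swap hF2 hqp (by simpa using h₂)

theorem reciprocity_of_pos
    (hF1 : ∀ p q : ℤ, Int.gcd p q = 1 → F p (-q) = F (-p) q)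
    (hF2 : ∀ p q : ℤ, Int.gcd p q = 1 → F p q * F (-q) p = 1)
    (hF3 : ∀ p q : ℤ, Int.gcd p q = 1 → F p (p + q) * F (p + q) q = F p q)
    {p q : ℤ} (hp : 0 < p) (hpq : Int.gcd p q = 1) :
    dedekindSymbol F p q = F p q * dedekindSymbol F (-q) p := by
  rcases lt_or_ge q 0 with hq | hq
  · exact reciprocity_of_pos_of_neg hF1 hF2 hF3 hp hq hpq
  rcases lt_or_ge q p with h | h
  · exact dedekindSymbol_of_lt F hq h
  · have hqp : Int.gcd q p = 1 := by rwa [Int.gcd_comm]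
    refine reciprocity_swap hF2 hqp ?_
    simpa using reciprocity_of_pos_of_neg hF1 hF2 hF3 (show 0 < q by lia) (neg_lt_zero.mpr hp)
      (by simpa using hqp)

theorem dedekindSymbol_reciprocity
    (hF1 : ∀ p q : ℤ, Int.gcd p q = 1 → F p (-q) = F (-p) q)
    (hF2 : ∀ p q : ℤ, Int.gcd p q = 1 → F p q * F (-q) p = 1)
    (hF3 : ∀ p q : ℤ, Int.gcd p q = 1 → F p (p + q) * F (p + q) q = F p q)
    {p q : ℤ} (hpq : Int.gcd p q = 1) :
    dedekindSymbol F p q = F p q * dedekindSymbol F (-q) p := by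
  have of_ne_zero {p q : ℤ} (hp : p ≠ 0) (hpq : Int.gcd p q = 1) :
      dedekindSymbol F p q = F p q * dedekindSymbol F (-q) p := by
    rcases hp.lt_or_gt with hp | hp
    · have hpq' : Int.gcd (-p) (-q) = 1 := by simpa using hpq
      simpa using reciprocity_neg hF1 hpq'
        (reciprocity_of_pos hF1 hF2 hF3 (neg_pos.mpr hp) hpq')
    · exact reciprocity_of_pos hF1 hF2 hF3 hp hpq
  by_cases hp : p = 0
  · have hq : q ≠ 0 := by
      rintro rfl
      simp [hp] at hpq
    have hqp : Int.gcd q p = 1 := by rwa [Int.gcd_comm]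
    exact reciprocity_swap hF2 hqp (by simpa using of_ne_zero hq (q := -p) (by simpa using hqp))
  · exact of_ne_zero hp hpq

end

/-- Fukuhara–Manin: for any `G`-valued reciprocity function `F` on
`U = {(p,q) : gcd(p,q) = 1}` there exists a `G`-valued Dedekind symbol `D` whose
associated function is `F`, i.e. `D(p,q)·D(-q,p)⁻¹ = F(p,q)` on `U`. -/
theorem exists_dedekind_symbol_of_reciprocity_function {G : Type*} [Group G]
    (F : ℤ → ℤ → G)
    (hF1 : ∀ p q : ℤ, Int.gcd p q = 1 → F p (-q) = F (-p) q)
    (hF2 : ∀ p q : ℤ, Int.gcd p q = 1 → F p q * F (-q) p = 1)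
    (hF3 : ∀ p q : ℤ, Int.gcd p q = 1 → F p (p + q) * F (p + q) q = F p q) :
    ∃ D : ℤ → ℤ → G,
      (∀ p q : ℤ, Int.gcd p q = 1 → D p (-q) = D (-p) q) ∧
      (∀ p q : ℤ, Int.gcd p q = 1 → D p q = D p (p + q)) ∧
      (∀ p q : ℤ, Int.gcd p q = 1 → D p q * (D (-q) p)⁻¹ = F p q) := by
  refine ⟨dedekindSymbol F, fun p q _ => dedekindSymbol_neg_right F p q,
    fun p q _ => (dedekindSymbol_add_self F p q).symm, fun p q hpq => ?_⟩
  rw [dedekindSymbol_reciprocity hF1 hF2 hF3 hpq, mul_inv_cancel_right]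
end

section
/- Let X be any set and let K : U → X be a function satisfying K(p,q) = K(p,p+q) and K(p,q) = K(-q,p) for all (p,q) ∈ U. Then K is constant on U. -/
theorem apply_add_mul_of_invariance {X : Type*} {K : ℤ → ℤ → X}
    (h1 : ∀ p q : ℤ, Int.gcd p q = 1 → K p q = K p (p + q))
    {p q : ℤ} (h : Int.gcd p q = 1) (k : ℤ) : K p (q + p * k) = K p q := by
  have hg (k : ℤ) : Int.gcd p (q + p * k) = 1 := by
    rw [← Int.isCoprime_iff_gcd_eq_one] at h ⊢
    exact h.add_mul_left_right k
  induction k using Int.induction_on with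
  | zero => simp
  | succ i ih =>
    rw [← ih, h1 p _ (hg i)]
    congr 1
    ring
  | pred i ih =>
    rw [← ih, h1 p _ (hg (-i - 1))]
    congr 1
    ring

theorem eq_apply_zero_one_of_invariance {X : Type*} {K : ℤ → ℤ → X}
    (h1 : ∀ p q : ℤ, Int.gcd p q = 1 → K p q = K p (p + q))
    (h2 : ∀ p q : ℤ, Int.gcd p q = 1 → K p q = K (-q) p)
    (p q : ℤ) (h : Int.gcd p q = 1) : K p q = K 0 1 := by
  induction hn : p.natAbs using Nat.strong_induction_on generalizing p q with
  | _ n ih =>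
    rcases eq_or_ne p 0 with rfl | hp
    · have hq : q.natAbs = 1 := by simpa using h
      rcases Int.natAbs_eq_iff.mp hq with rfl | rfl
      · rfl
      · exact (h2 0 (-1) (by simp)).trans (h2 1 0 (by simp))
    · have hr : Int.gcd p (q % p) = 1 := by
        rwa [Int.gcd_comm, Int.gcd_emod, Int.gcd_comm]
      have hK : K p q = K p (q % p) := by
        conv_lhs => rw [← Int.emod_add_mul_ediv q p]
        exact apply_add_mul_of_invariance h1 hr _
      rw [hK, h2 p _ hr]
      refine ih _ ?_ _ _ ?_ rfl
      · have := Int.emod_nonneg q hp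
        have := Int.emod_lt_abs q hp
        rw [Int.abs_eq_natAbs] at this
        omega
      · rwa [Int.neg_gcd, Int.gcd_comm]

/-- a function `K` on `U = {(p,q) : gcd(p,q) = 1}` satisfying
`K(p,q) = K(p,p+q)` and `K(p,q) = K(-q,p)` is constant on `U`. -/
theorem constant_of_invariance {X : Type*} (K : ℤ → ℤ → X)
    (h1 : ∀ p q : ℤ, Int.gcd p q = 1 → K p q = K p (p + q))
    (h2 : ∀ p q : ℤ, Int.gcd p q = 1 → K p q = K (-q) p) :
    ∀ p q p' q' : ℤ, Int.gcd p q = 1 → Int.gcd p' q' = 1 → K p q = K p' q' := by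
  intro p q p' q' h h'
  rw [eq_apply_zero_one_of_invariance h1 h2 p q h, eq_apply_zero_one_of_invariance h1 h2 p' q' h']
end

section
/- Let p ≥ 1 and q be coprime integers. Then there exists a unique finite sequence (a_0,a_1,…,a_n) of integers with a_i ≥ 2 for all 1 ≤ i ≤ n such that P^{(n)}(a_0,…,a_n) = p and Q^{(n)}(a_0,…,a_n) = q. In particular every rational number has a unique continued fraction representation q/p = ⟨a_0,…,a_n⟩ with a_i ≥ 2 for 1 ≤ i ≤ n. -/
namespace Stmt6

/-- `PQ (a_0,…,a_n) = (P^{(n)}(a_0,…,a_n), Q^{(n)}(a_0,…,a_n))`, where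
`P^{(0)}(a_0) = 1`, `Q^{(0)}(a_0) = a_0`, `P^{(n+1)}(a_0,…,a_{n+1}) = Q^{(n)}(a_1,…,a_{n+1})`
and `Q^{(n+1)}(a_0,…,a_{n+1}) = a_0·Q^{(n)}(a_1,…,a_{n+1}) − P^{(n)}(a_1,…,a_{n+1})`. -/
def PQ : List ℤ → ℤ × ℤ
  | [] => (0, 1)
  | a :: l => ((PQ l).2, a * (PQ l).2 - (PQ l).1)

/-- `P^{(n)}(a_0,…,a_n)`. -/
def P (l : List ℤ) : ℤ := (PQ l).1

/-- `Q^{(n)}(a_0,…,a_n)`. -/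
def Q (l : List ℤ) : ℤ := (PQ l).2

theorem PQ_bounds (l : List ℤ) (hl : ∀ x ∈ l, 2 ≤ x) : 0 ≤ (PQ l).1 ∧ (PQ l).1 < (PQ l).2 := by
  induction l with
  | nil => simp [PQ]
  | cons a l ih =>
    obtain ⟨h0, h1⟩ := ih fun x hx => hl x (List.mem_cons_of_mem a hx)
    have ha : 2 ≤ a := hl a List.mem_cons_self
    refine ⟨?_, ?_⟩ <;> simp only [PQ] <;> nlinarith

/-- Equality of the numerators and denominators determines the first entry and those of the
remaining sequences. -/
theorem PQ_cons_inj {a b : ℤ} {l m : List ℤ} (hl : ∀ x ∈ l, 2 ≤ x) (hm : ∀ x ∈ m, 2 ≤ x)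
    (h : PQ (a :: l) = PQ (b :: m)) : a = b ∧ PQ l = PQ m := by
  obtain ⟨hl0, hl1⟩ := PQ_bounds l hl
  obtain ⟨hm0, hm1⟩ := PQ_bounds m hm
  simp only [PQ, Prod.mk.injEq] at h
  obtain ⟨h1, h2⟩ := h
  rw [← h1] at h2 hm1
  have hab : a = b := by
    rcases lt_trichotomy a b with hlt | heq | hgt
    · nlinarith
    · exact heq
    · nlinarith
  subst hab
  exact ⟨rfl, Prod.ext (by linarith) h1⟩

theorem PQ_injOn (l m : List ℤ) (hl : ∀ x ∈ l, 2 ≤ x) (hm : ∀ x ∈ m, 2 ≤ x)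
    (h : PQ l = PQ m) : l = m := by
  induction l generalizing m with
  | nil =>
    cases m with
    | nil => rfl
    | cons b m =>
      have := PQ_bounds m fun x hx => hm x (List.mem_cons_of_mem b hx)
      simp only [PQ, Prod.mk.injEq] at h
      omega
  | cons a l ih =>
    have hl' : ∀ x ∈ l, 2 ≤ x := fun x hx => hl x (List.mem_cons_of_mem a hx)
    cases m with
    | nil =>
      have := PQ_bounds l hl'
      simp only [PQ, Prod.mk.injEq] at h
      omega
    | cons b m =>
      have hm' : ∀ x ∈ m, 2 ≤ x := fun x hx => hm x (List.mem_cons_of_mem b hx)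
      obtain ⟨rfl, h'⟩ := PQ_cons_inj hl' hm' h
      rw [ih m hl' hm' h']

/-- Division with negative remainder: `q = a * p - r` with `0 ≤ r < p`, preserving coprimality. -/
theorem exists_eq_mul_sub {p q : ℤ} (hp : 1 ≤ p) (h : IsCoprime p q) :
    ∃ a r : ℤ, q = a * p - r ∧ 0 ≤ r ∧ r < p ∧ IsCoprime r p := by
  have hdiv := Int.emod_add_mul_ediv (-q) p
  refine ⟨-(-q / p), -q % p, by linarith, Int.emod_nonneg _ (by omega),
    Int.emod_lt_of_pos _ (by omega), ?_⟩
  have hr : -q % p = -q + p * -(-q / p) := by linarith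
  rw [hr]
  exact h.symm.neg_left.add_mul_left_left _

theorem exists_PQ_eq (n : ℕ) (q : ℤ) (hq : (n : ℤ) < q) (h : IsCoprime (n : ℤ) q) :
    ∃ l : List ℤ, (∀ x ∈ l, 2 ≤ x) ∧ PQ l = ((n : ℤ), q) := by
  induction n using Nat.strong_induction_on generalizing q with
  | _ n ih =>
    rcases Nat.eq_zero_or_pos n with rfl | hn
    · refine ⟨[], by simp, ?_⟩
      rw [Nat.cast_zero, isCoprime_zero_left, Int.isUnit_iff] at h
      have hq1 : q = 1 := by omega
      simp [PQ, hq1]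
    · obtain ⟨a, r, rfl, hr0, hrn, hcop⟩ := exists_eq_mul_sub (by omega) h
      lift r to ℕ using hr0
      obtain ⟨l, hl, hPQ⟩ := ih r (by omega) n hrn hcop
      have ha : 2 ≤ a := by
        by_contra! hlt
        nlinarith
      exact ⟨a :: l, List.forall_mem_cons.2 ⟨ha, hl⟩, by simp [PQ, hPQ]⟩

/-- for coprime integers `p ≥ 1` and `q` there is a unique nonempty finite
sequence `(a_0,a_1,…,a_n)` of integers with `a_i ≥ 2` for `1 ≤ i ≤ n` (i.e. every entry of
the tail is at least `2`) such that `P^{(n)}(a_0,…,a_n) = p` and `Q^{(n)}(a_0,…,a_n) = q`;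
in other words `q/p` has a unique continued fraction representation `⟨a_0,…,a_n⟩` with
`a_i ≥ 2` for `1 ≤ i ≤ n`. -/
theorem existsUnique_continued_fraction (p q : ℤ) (hp : 1 ≤ p) (h : Int.gcd p q = 1) :
    ∃! l : List ℤ, l ≠ [] ∧ (∀ x ∈ l.tail, 2 ≤ x) ∧ P l = p ∧ Q l = q := by
  obtain ⟨a, r, rfl, hr0, hrp, hcop⟩ := exists_eq_mul_sub hp (Int.isCoprime_iff_gcd_eq_one.2 h)
  lift r to ℕ using hr0
  obtain ⟨l, hl, hPQ⟩ := exists_PQ_eq r p hrp hcop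
  refine ⟨a :: l, ⟨by simp, hl, by simp [P, PQ, hPQ], by simp [Q, PQ, hPQ]⟩, ?_⟩
  rintro (_ | ⟨b, m⟩) ⟨hne, hm, hP, hQ⟩
  · exact absurd rfl hne
  · have hbm : PQ (b :: m) = PQ (a :: l) :=
      Prod.ext (hP.trans (by simp [PQ, hPQ])) (hQ.trans (by simp [PQ, hPQ]))
    obtain ⟨rfl, hml⟩ := PQ_cons_inj hm hl hbm
    rw [PQ_injOn m l hm hl hml]

end Stmt6
end

section
/- Let G be a group and F a G-valued reciprocity function. For a finite integer sequence a = (a_0,…,a_n) set D(a) = F(P^{(n−1)}(a_1,…,a_n), Q^{(n−1)}(a_1,…,a_n))⁻¹ · F(P^{(n−2)}(a_2,…,a_n), Q^{(n−2)}(a_2,…,a_n))⁻¹ ⋯ F(P^{(0)}(a_n), Q^{(0)}(a_n))⁻¹ (the product taken in this order; the empty product, when n = 0, is 1). If a = (a_0,…,a_n) and b = (b_0,…,b_m) are two sequences with P^{(n)}(a_0,…,a_n) ≠ 0, P^{(m)}(b_0,…,b_m) ≠ 0 and Q^{(n)}(a_0,…,a_n)·P^{(m)}(b_0,…,b_m)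 = Q^{(m)}(b_0,…,b_m)·P^{(n)}(a_0,…,a_n) (i.e. they represent the same rational number as continued fractions), then D(a) = D(b). In particular D(a) depends only on the rational number ⟨a_0,…,a_n⟩. -/
namespace Stmt8

/-- `PQ (a_0,…,a_n) = (P^{(n)}(a_0,…,a_n), Q^{(n)}(a_0,…,a_n))`, where
`P^{(0)}(a_0) = 1`, `Q^{(0)}(a_0) = a_0`, `P^{(n+1)}(a_0,…,a_{n+1}) = Q^{(n)}(a_1,…,a_{n+1})`
and `Q^{(n+1)}(a_0,…,a_{n+1}) = a_0·Q^{(n)}(a_1,…,a_{n+1}) − P^{(n)}(a_1,…,a_{n+1})`. -/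
def PQ : List ℤ → ℤ × ℤ
  | [] => (0, 1)
  | a :: l => ((PQ l).2, a * (PQ l).2 - (PQ l).1)

/-- `P^{(n)}(a_0,…,a_n)`. -/
def P (l : List ℤ) : ℤ := (PQ l).1

/-- `Q^{(n)}(a_0,…,a_n)`. -/
def Q (l : List ℤ) : ℤ := (PQ l).2

/-- For a sequence `a = (a_0,…,a_n)`, `DF F a` is the ordered product
`F(P^{(n−1)}(a_1,…,a_n), Q^{(n−1)}(a_1,…,a_n))⁻¹ ⋯ F(P^{(0)}(a_n), Q^{(0)}(a_n))⁻¹`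
(equal to `1` when `n = 0`). -/
def DF {G : Type*} [Group G] (F : ℤ → ℤ → G) : List ℤ → G
  | [] => 1
  | [_] => 1
  | _ :: y :: l => (F (P (y :: l)) (Q (y :: l)))⁻¹ * DF F (y :: l)

/-- The `G`-valued potential on coprime pairs `(p, q)` with `p ≥ 0`, computed by the Euclidean
algorithm. It is `p`-periodic in `q`. -/
def natPotential {G : Type*} [Group G] (F : ℤ → ℤ → G) (p : ℕ) (q : ℤ) : G :=
  if _h : p = 0 then 1
  else (F ((-q) % (p : ℤ)) p)⁻¹ * natPotential F ((-q) % (p : ℤ)).toNat p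
termination_by p
decreasing_by
  have h1 := Int.emod_lt_of_pos (-q) (by omega : (0 : ℤ) < p)
  omega

/-- The extension of `natPotential` to all pairs of integers, invariant under
`(p, q) ↦ (-p, -q)`. -/
def potential {G : Type*} [Group G] (F : ℤ → ℤ → G) (p q : ℤ) : G :=
  natPotential F p.natAbs (p.sign * q)

section Potential

variable {G : Type*} [Group G] (F : ℤ → ℤ → G)

theorem natPotential_zero (q : ℤ) : natPotential F 0 q = 1 := by
  rw [natPotential, dif_pos rfl]

theorem natPotential_congr {p : ℕ} {q r : ℤ} (h : (-q) % (p : ℤ) = (-r) % (p : ℤ)) :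
    natPotential F p q = natPotential F p r := by
  rw [natPotential.eq_def F p q, natPotential.eq_def F p r, h]

theorem natPotential_add_mul (p : ℕ) (q k : ℤ) :
    natPotential F p (q + k * p) = natPotential F p q := by
  apply natPotential_congr
  rw [show -(q + k * p) = -q + p * (-k) by ring, Int.add_mul_emod_self_left]

theorem natPotential_neg {p q : ℕ} (h : p < q) :
    natPotential F q (-p) = (F p q)⁻¹ * natPotential F p q := by
  have hm : (- -(p : ℤ)) % (q : ℤ) = p := by
    rw [neg_neg]
    exact Int.emod_eq_of_lt (by omega) (by omega)
  rw [natPotential, dif_neg (by omega), hm, Int.toNat_natCast]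

theorem natPotential_eq_mul
    (hF3 : ∀ p q : ℤ, Int.gcd p q = 1 → F p (p + q) * F (p + q) q = F p q)
    (p q : ℕ) (hq : 0 < q) (hpq : Int.gcd p q = 1) :
    natPotential F p q = F p q * natPotential F q (-p) := by
  induction p using Nat.strong_induction_on with
  | _ p ih =>
    rcases lt_or_ge p q with h | h
    · rw [natPotential_neg F h, mul_inv_cancel_left]
    · obtain ⟨r, rfl⟩ := Nat.exists_eq_add_of_le' h
      have hrq : Int.gcd r q = 1 := by simpa using hpq
      have h1 : natPotential F (r + q) q = (F r (r + q : ℕ))⁻¹ * natPotential F r (r + q : ℕ) := by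
        rw [← natPotential_neg F (by omega : r < r + q), ← natPotential_add_mul F (r + q) (-r) 1]
        congr 1
        push_cast
        ring
      have h2 : natPotential F r (r + q : ℕ) = natPotential F r q := by
        rw [← natPotential_add_mul F r q 1]
        congr 1
        push_cast
        ring
      have h3 : natPotential F q (-(r + q : ℕ)) = natPotential F q (-r) := by
        rw [← natPotential_add_mul F q (-(r + q : ℕ)) 1]
        congr 1
        push_cast
        ring
      rw [h1, h2, h3, ih r (by omega) hrq]
      push_cast
      rw [← hF3 r q hrq]
      group

theorem potential_neg_neg (p q : ℤ) : potential F (-p) (-q) = potential F p q := by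
  simp [potential, Int.sign_neg]

theorem potential_add_mul (p q k : ℤ) : potential F p (q + k * p) = potential F p q := by
  rw [potential, potential, ← natPotential_add_mul F p.natAbs (p.sign * q) k]
  congr 1
  rw [← Int.sign_mul_self_eq_natAbs]
  ring

theorem potential_eq_mul_of_nonneg
    (hF3 : ∀ p q : ℤ, Int.gcd p q = 1 → F p (p + q) * F (p + q) q = F p q)
    {p q : ℤ} (hp : 0 ≤ p) (hq : 0 < q) (hpq : Int.gcd p q = 1) :
    potential F p q = F p q * potential F q (-p) := by
  lift p to ℕ using hp
  lift q to ℕ using hq.le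
  have hq' : 0 < q := by omega
  have h := natPotential_eq_mul F hF3 p q hq' hpq
  have hr : potential F q (-p) = natPotential F q (-p) := by
    simp [potential, Int.sign_eq_one_of_pos hq]
  have hl : potential F p q = natPotential F p q := by
    rcases Nat.eq_zero_or_pos p with rfl | hp
    · simp [potential, natPotential_zero]
    · simp [potential, Int.sign_eq_one_of_pos (by omega : (0 : ℤ) < p)]
  rw [hl, hr, h]

theorem potential_eq_mul
    (hF1 : ∀ p q : ℤ, Int.gcd p q = 1 → F p (-q) = F (-p) q)
    (hF2 : ∀ p q : ℤ, Int.gcd p q = 1 → F p q * F (-q) p = 1)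
    (hF3 : ∀ p q : ℤ, Int.gcd p q = 1 → F p (p + q) * F (p + q) q = F p q)
    (p q : ℤ) (hpq : Int.gcd p q = 1) :
    potential F p q = F p q * potential F q (-p) := by
  have of_pos : ∀ p q : ℤ, 0 < p → Int.gcd p q = 1 →
      potential F p q = F p q * potential F q (-p) := by
    intro p q hp hpq
    rcases lt_or_ge 0 q with hq | hq
    · exact potential_eq_mul_of_nonneg F hF3 hp.le hq hpq
    · have h := potential_eq_mul_of_nonneg F hF3 (p := -q) (q := p) (by omega) hp
        (by rwa [Int.neg_gcd, Int.gcd_comm])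
      rw [neg_neg] at h
      rw [← potential_neg_neg F q, neg_neg, h, ← mul_assoc, hF2 p q hpq, one_mul]
  rcases lt_trichotomy p 0 with hp | rfl | hp
  · have h := of_pos (-p) (-q) (by omega) (by simpa using hpq)
    rwa [potential_neg_neg, potential_neg_neg, ← hF1 _ _ (by simpa using hpq), neg_neg]
      at h
  · have hq : q ≠ 0 := by
      rintro rfl
      simp at hpq
    rcases lt_or_gt_of_ne hq with hq | hq
    · have h := potential_eq_mul_of_nonneg F hF3 (p := 0) (q := -q) le_rfl (by omega)
        (by simpa using hpq)
      rw [hF1 0 q hpq, neg_zero] at h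
      simpa [← potential_neg_neg F 0 q, ← potential_neg_neg F q 0] using h
    · exact potential_eq_mul_of_nonneg F hF3 le_rfl hq hpq
  · exact of_pos p q hp hpq

end Potential

theorem gcd_P_Q (l : List ℤ) : Int.gcd (P l) (Q l) = 1 := by
  induction l with
  | nil => simp [P, Q, PQ]
  | cons a l ih =>
    change Int.gcd (Q l) (a * Q l - P l) = 1
    rw [← Int.isCoprime_iff_gcd_eq_one] at ih ⊢
    obtain ⟨u, v, h⟩ := ih
    exact ⟨v + u * a, -u, by linear_combination h⟩

theorem DF_eq_potential_mul {G : Type*} [Group G] (F : ℤ → ℤ → G)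
    (hF1 : ∀ p q : ℤ, Int.gcd p q = 1 → F p (-q) = F (-p) q)
    (hF2 : ∀ p q : ℤ, Int.gcd p q = 1 → F p q * F (-q) p = 1)
    (hF3 : ∀ p q : ℤ, Int.gcd p q = 1 → F p (p + q) * F (p + q) q = F p q)
    (l : List ℤ) (hl : l ≠ []) :
    DF F l = potential F (P l) (Q l) * F 0 1 := by
  have step : ∀ (a : ℤ) (l : List ℤ), potential F (P (a :: l)) (Q (a :: l)) =
      (F (P l) (Q l))⁻¹ * potential F (P l) (Q l) := by
    intro a l
    change potential F (Q l) (a * Q l - P l) = _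
    rw [potential_eq_mul F hF1 hF2 hF3 (P l) (Q l) (gcd_P_Q l), inv_mul_cancel_left,
      ← potential_add_mul F (Q l) (-P l) a]
    congr 1
    ring
  induction l with
  | nil => exact absurd rfl hl
  | cons a l ih =>
    rw [step]
    cases l with
    | nil => simp [DF, P, Q, PQ, potential, natPotential_zero]
    | cons b l => rw [DF, ih (by simp), mul_assoc]

theorem eq_or_eq_neg_of_mul_eq_mul {p q r s : ℤ} (hpq : Int.gcd p q = 1) (hrs : Int.gcd r s = 1)
    (h : q * r = s * p) (hp : p ≠ 0) : (r = p ∧ s = q) ∨ (r = -p ∧ s = -q) := by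
  have h1 : p ∣ r := (Int.isCoprime_iff_gcd_eq_one.2 hpq).dvd_of_dvd_mul_left ⟨s, by rw [h]; ring⟩
  have h2 : r ∣ p := (Int.isCoprime_iff_gcd_eq_one.2 hrs).dvd_of_dvd_mul_left ⟨q, by rw [← h]; ring⟩
  rcases Int.natAbs_eq_natAbs_iff.1 (Int.natAbs_eq_of_dvd_dvd h2 h1) with rfl | rfl
  · exact Or.inl ⟨rfl, (mul_right_cancel₀ hp h).symm⟩
  · exact Or.inr ⟨rfl, mul_right_cancel₀ hp (by linear_combination -h)⟩

/-- if `F` is a `G`-valued reciprocity function and two nonempty integer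
sequences `a`, `b` represent the same rational number as continued fractions (i.e.
`P(a) ≠ 0`, `P(b) ≠ 0` and `Q(a)·P(b) = Q(b)·P(a)`), then `DF F a = DF F b`; so
`DF F a` depends only on the rational number `⟨a_0,…,a_n⟩`. -/
theorem DF_well_defined {G : Type*} [Group G] (F : ℤ → ℤ → G)
    (hF1 : ∀ p q : ℤ, Int.gcd p q = 1 → F p (-q) = F (-p) q)
    (hF2 : ∀ p q : ℤ, Int.gcd p q = 1 → F p q * F (-q) p = 1)
    (hF3 : ∀ p q : ℤ, Int.gcd p q = 1 → F p (p + q) * F (p + q) q = F p q)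
    (a b : List ℤ) (ha : a ≠ []) (hb : b ≠ [])
    (hPa : P a ≠ 0) (hPb : P b ≠ 0)
    (hab : Q a * P b = Q b * P a) :
    DF F a = DF F b := by
  rw [DF_eq_potential_mul F hF1 hF2 hF3 a ha, DF_eq_potential_mul F hF1 hF2 hF3 b hb]
  rcases eq_or_eq_neg_of_mul_eq_mul (gcd_P_Q a) (gcd_P_Q b) hab hPa with ⟨hP, hQ⟩ | ⟨hP, hQ⟩
  · rw [hP, hQ]
  · rw [hP, hQ, potential_neg_neg]

end Stmt8
end

section
/- Let a = (a_0,…,a_n) be a finite sequence of integers and let b be obtained from a by one of the moves (T1), (T2), (T3). Then Q(b)·P(a) = Q(a)·P(b), where P(a) = P^{(n)}(a_0,…,a_n) and Q(a) = Q^{(n)}(a_0,…,a_n) (and similarly for b with its own length). In particular, whenever P(a) and P(b) are nonzero, the continued fractions of a and b define the same rational number. -/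
namespace Stmt9

/-- `PQ (a_0,…,a_n) = (P^{(n)}(a_0,…,a_n), Q^{(n)}(a_0,…,a_n))`, where
`P^{(0)}(a_0) = 1`, `Q^{(0)}(a_0) = a_0`, `P^{(n+1)}(a_0,…,a_{n+1}) = Q^{(n)}(a_1,…,a_{n+1})`
and `Q^{(n+1)}(a_0,…,a_{n+1}) = a_0·Q^{(n)}(a_1,…,a_{n+1}) − P^{(n)}(a_1,…,a_{n+1})`. -/
def PQ : List ℤ → ℤ × ℤ
  | [] => (0, 1)
  | a :: l => ((PQ l).2, a * (PQ l).2 - (PQ l).1)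

/-- `P^{(n)}(a_0,…,a_n)`. -/
def P (l : List ℤ) : ℤ := (PQ l).1

/-- `Q^{(n)}(a_0,…,a_n)`. -/
def Q (l : List ℤ) : ℤ := (PQ l).2

/-- Proportionality of the pairs `PQ` of two sequences persists after prepending a common prefix. -/
theorem PQ_append_eq_smul {m m' : List ℤ} {k : ℤ} (h : PQ m' = k • PQ m) (l : List ℤ) :
    PQ (l ++ m') = k • PQ (l ++ m) := by
  induction l with
  | nil => exact h
  | cons a l ih =>
    simp only [List.cons_append, PQ, ih, Prod.smul_mk, Prod.smul_fst, Prod.smul_snd, smul_eq_mul]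
    congr 1
    ring

theorem Q_mul_P_append_of_PQ_eq_smul {m m' : List ℤ} {k : ℤ} (h : PQ m' = k • PQ m)
    (l : List ℤ) : Q (l ++ m') * P (l ++ m) = Q (l ++ m) * P (l ++ m') := by
  simp only [P, Q, PQ_append_eq_smul h l, Prod.smul_fst, Prod.smul_snd, smul_eq_mul]
  ring

/-- the three moves (T1), (T2), (T3) on a finite integer sequence preserve the
continued fraction value, in the cross-multiplied form `Q(b)·P(a) = Q(a)·P(b)`:
(T1) `(…, a_i, a_{i+1}, …) ↦ (…, a_i+ε, ε, a_{i+1}+ε, …)` with `ε = ±1`;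
(T2) `(…, b+c, …) ↦ (…, b, 0, c, …)`;
(T3) `(a_0, …, a_n) ↦ (a_0, …, a_{n-1}, a_n+ε, ε)` with `ε = ±1`.
In particular, whenever `P(a)` and `P(b)` are nonzero, the continued fractions of `a`
and `b` define the same rational number. -/
theorem moves_preserve_value :
    (∀ (l₁ l₂ : List ℤ) (x y ε : ℤ), ε = 1 ∨ ε = -1 →
      Q (l₁ ++ (x + ε) :: ε :: (y + ε) :: l₂) * P (l₁ ++ x :: y :: l₂) =
        Q (l₁ ++ x :: y :: l₂) * P (l₁ ++ (x + ε) :: ε :: (y + ε) :: l₂)) ∧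
    (∀ (l₁ l₂ : List ℤ) (b c : ℤ),
      Q (l₁ ++ b :: 0 :: c :: l₂) * P (l₁ ++ (b + c) :: l₂) =
        Q (l₁ ++ (b + c) :: l₂) * P (l₁ ++ b :: 0 :: c :: l₂)) ∧
    (∀ (l₁ : List ℤ) (x ε : ℤ), ε = 1 ∨ ε = -1 →
      Q (l₁ ++ [x + ε, ε]) * P (l₁ ++ [x]) =
        Q (l₁ ++ [x]) * P (l₁ ++ [x + ε, ε])) := by
  refine ⟨fun l₁ l₂ x y ε hε => ?_, fun l₁ l₂ b c => ?_, fun l₁ x ε hε => ?_⟩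
  · refine Q_mul_P_append_of_PQ_eq_smul (k := ε) ?_ l₁
    rcases hε with rfl | rfl <;> ext <;> simp [PQ] <;> ring
  · refine Q_mul_P_append_of_PQ_eq_smul (k := -1) ?_ l₁
    ext <;> simp [PQ]
    ring
  · refine Q_mul_P_append_of_PQ_eq_smul (k := ε) ?_ l₁
    rcases hε with rfl | rfl <;> ext <;> simp [PQ]

end Stmt9
end

section
/- Let (D^w) be a normalized componentwise R-valued multiple Dedekind symbol with associated family (F^w), and let n ≥ 1 be an integer. Then F^w = 0 for all words w with 0 < l(w) < n if and only if D^w = 0 for all words w with 0 < l(w) < n. -/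
theorem Int.eq_add_mul_of_periodic_on_coprime {R : Type*} {f : ℤ → ℤ → R}
    (hT : ∀ p q : ℤ, Int.gcd p q = 1 → f p q = f p (p + q))
    (p q : ℤ) (h : Int.gcd p q = 1) (k : ℤ) : f p q = f p (q + p * k) := by
  have hg : ∀ j : ℤ, Int.gcd p (q + p * j) = 1 := fun j => by simpa using h
  induction k with
  | zero => simp
  | succ i ih =>
    rw [ih, hT p _ (hg i)]
    congr 1
    ring
  | pred i ih =>
    rw [ih, hT p _ (hg (-i - 1))]
    congr 1
    ring

/-- A function on coprime pairs invariant under `(p, q) ↦ (p, p + q)` and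
`(p, q) ↦ (-q, p)` is constant. -/
theorem Int.eq_one_one_of_invariant_on_coprime {R : Type*} {f : ℤ → ℤ → R}
    (hT : ∀ p q : ℤ, Int.gcd p q = 1 → f p q = f p (p + q))
    (hS : ∀ p q : ℤ, Int.gcd p q = 1 → f p q = f (-q) p)
    (p q : ℤ) (h : Int.gcd p q = 1) : f p q = f 1 1 := by
  induction hm : p.natAbs using Nat.strong_induction_on generalizing p q with
  | _ m ih =>
    by_cases hp : p = 0
    · subst hp
      have h10 : f 1 0 = f 1 1 := by simpa using hT 1 0 (by simp)
      have h0n : f 0 (-1) = f 1 0 := by simpa using hS 0 (-1) (by simp)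
      have hn0 : f (-1) 0 = f 0 (-1) := by simpa using hS (-1) 0 (by simp)
      have h01 : f 0 1 = f (-1) 0 := hS 0 1 (by simp)
      rw [Int.gcd_zero_left] at h
      rcases Int.natAbs_eq q with hq | hq <;> rw [h] at hq <;> subst hq
      · exact h01.trans (hn0.trans (h0n.trans h10))
      · exact h0n.trans h10
    · have hmod : q + p * (-(q / p)) = q % p := by
        rw [Int.emod_def]; ring
      have hg : Int.gcd p (q % p) = 1 := by
        rw [← hmod]; simpa using h
      have hlt : (-(q % p)).natAbs < m := by
        have := Int.emod_nonneg q hp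
        have := Int.emod_lt_abs q hp
        rw [Int.abs_eq_natAbs] at this
        omega
      rw [Int.eq_add_mul_of_periodic_on_coprime hT p q h (-(q / p)), hmod, hS _ _ hg]
      exact ih _ hlt _ _ (by rw [Int.neg_gcd, Int.gcd_comm]; exact hg) rfl


/-- for a normalized componentwise `R`-valued multiple Dedekind symbol
`(D^w)` with associated family `(F^w)` (so `D^w(p,q) = Σ_{w=uv} F^u(p,q)·D^v(-q,p)` on `U`)
and an integer `n ≥ 1`: `F^w` vanishes on `U` for all words with `0 < l(w) < n` iff `D^w`
vanishes on `U` for all words with `0 < l(w) < n`. -/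
theorem vanishing_iff {R : Type*} [CommRing R] {A : Type*}
    (D F : List A → ℤ → ℤ → R)
    (hD0 : ∀ p q : ℤ, D [] p q = 1)
    (hDsym : ∀ w : List A, w ≠ [] → ∀ p q : ℤ, Int.gcd p q = 1 → D w p (-q) = D w (-p) q)
    (hDper : ∀ w : List A, w ≠ [] → ∀ p q : ℤ, Int.gcd p q = 1 → D w p q = D w p (p + q))
    (hDnorm : ∀ w : List A, w ≠ [] → D w 1 1 = 0)
    (hF0 : ∀ p q : ℤ, F [] p q = 1)
    (hFD : ∀ w : List A, ∀ p q : ℤ, Int.gcd p q = 1 →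
      D w p q = ∑ i ∈ Finset.range (w.length + 1),
        F (w.take i) p q * D (w.drop i) (-q) p)
    (n : ℕ) (hn : 1 ≤ n) :
    (∀ w : List A, 0 < w.length → w.length < n →
        ∀ p q : ℤ, Int.gcd p q = 1 → F w p q = 0) ↔
    (∀ w : List A, 0 < w.length → w.length < n →
        ∀ p q : ℤ, Int.gcd p q = 1 → D w p q = 0) := by
  constructor
  · intro hF w hw hwn p q hpq
    have hne : w ≠ [] := List.length_pos_iff.mp hw
    rw [← hDnorm w hne]
    refine Int.eq_one_one_of_invariant_on_coprime (hDper w hne) (fun a b hab => ?_) p q hpq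
    rw [hFD w a b hab, Finset.sum_eq_single 0]
    · simp [hF0]
    · intro i hi hi0
      have hi' := Finset.mem_range.mp hi
      rw [hF _ (by rw [List.length_take]; omega) (by rw [List.length_take]; omega) a b hab,
        zero_mul]
    · simp
  · intro hD w hw hwn p q hpq
    have hqp : Int.gcd (-q) p = 1 := by rw [Int.neg_gcd, Int.gcd_comm]; exact hpq
    have key := hFD w p q hpq
    rw [hD w hw hwn p q hpq, Finset.sum_eq_single w.length] at key
    · simpa [hD0] using key.symm
    · intro i hi hil
      have hi' := Finset.mem_range.mp hi
      rw [hD _ (by rw [List.length_drop]; omega) (by rw [List.length_drop]; omega) _ _ hqp,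
        mul_zero]
    · simp
end

section
/- Let (D^w) and (E^w) be normalized componentwise R-valued multiple Dedekind symbols with associated families (F^w) and (G^w) respectively, and let m, n ≥ 1 be integers such that F^w = 0 for all words with 0 < l(w) < m and G^w = 0 for all words with 0 < l(w) < n. Then the product family (DE)^w(p,q) = Σ_{w=uv} D^u(p,q)·E^v(p,q) is a normalized componentwise multiple Dedekind symbol, and its associated family (H^w) satisfies: H^w = 0 for all words with 0 < l(w) < min(m,n), and H^w = F^w + G^w for all words with l(w) = min(m,n). -/
/-- A sum over `0, …, N` whose interior terms vanish reduces to its two end terms. -/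
theorem sum_range_succ_eq_ends {R : Type*} [CommRing R] {N : ℕ} (hN : 0 < N) (f : ℕ → R)
    (hf : ∀ i, 0 < i → i < N → f i = 0) :
    ∑ i ∈ Finset.range (N + 1), f i = f 0 + f N := by
  obtain ⟨k, rfl⟩ : ∃ k, N = k + 1 := ⟨N - 1, by omega⟩
  rw [Finset.sum_range_succ, Finset.sum_range_succ', Finset.sum_eq_zero, zero_add]
  intro i hi
  have := Finset.mem_range.mp hi
  exact hf _ (by omega) (by omega)

theorem gcd_add_mul_self_eq_one {p q : ℤ} (h : Int.gcd p q = 1) (k : ℤ) :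
    Int.gcd p (q + k * p) = 1 := by
  rw [← Int.isCoprime_iff_gcd_eq_one] at h ⊢
  rw [mul_comm]
  exact h.add_mul_left_right k

/-- Translation by `p` in the second argument may be iterated any integer number of times. -/
theorem eq_add_mul_of_periodic {R : Type*} (f : ℤ → ℤ → R)
    (hper : ∀ p q : ℤ, Int.gcd p q = 1 → f p q = f p (p + q))
    {p q : ℤ} (h : Int.gcd p q = 1) (k : ℤ) : f p (q + k * p) = f p q := by
  induction k with
  | zero => simp
  | succ k ih =>
    rw [← ih, hper _ _ (gcd_add_mul_self_eq_one h k)]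
    congr 1
    ring
  | pred k ih =>
    rw [← ih, hper _ _ (gcd_add_mul_self_eq_one h (-(k : ℤ) - 1))]
    congr 1
    ring

/-- A function on coprime pairs that is invariant under the two generators of the modular group
and is even is constant. -/
theorem eq_one_one_of_modular_invariant {R : Type*} (f : ℤ → ℤ → R)
    (hsym : ∀ p q : ℤ, Int.gcd p q = 1 → f p (-q) = f (-p) q)
    (hper : ∀ p q : ℤ, Int.gcd p q = 1 → f p q = f p (p + q))
    (hrot : ∀ p q : ℤ, Int.gcd p q = 1 → f p q = f (-q) p)
    (p q : ℤ) (h : Int.gcd p q = 1) : f p q = f 1 1 := by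
  induction hN : p.natAbs using Nat.strong_induction_on generalizing p q with
  | _ N ih =>
    rcases eq_or_ne p 0 with rfl | hp
    · have h10 : f 1 0 = f 1 1 := by simpa using hper 1 0 (by simp)
      have h10' : f (-1) 0 = f 1 0 := by simpa using (hsym 1 0 (by simp)).symm
      rw [hrot _ _ h]
      have hq : q.natAbs = 1 := by simpa using h
      rcases Int.natAbs_eq_iff.mp hq with rfl | rfl
      · simpa using h10'.trans h10
      · simpa using h10
    · have hmod : q + -(q / p) * p = q % p := by
        have := Int.emod_add_mul_ediv q p
        linarith
      have hg := gcd_add_mul_self_eq_one h (-(q / p))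
      have hf := eq_add_mul_of_periodic f hper h (-(q / p))
      rw [hmod] at hg hf
      have h1 := Int.emod_nonneg q hp
      have h2 := Int.emod_lt_abs q hp
      rw [Int.abs_eq_natAbs] at h2
      rw [← hf, hrot _ _ hg]
      refine ih _ ?_ _ _ (by rwa [Int.neg_gcd, Int.gcd_comm]) rfl
      omega

/-- If in each splitting of `w` into two nonempty words one of the factors contributes zero, then
the associated family at `w` is the difference of `D` and its rotation. -/
theorem associated_eq_sub_of_interior_vanishing {R : Type*} [CommRing R] {A : Type*}
    (D F : List A → ℤ → ℤ → R) (hD0 : ∀ p q : ℤ, D [] p q = 1) (hF0 : ∀ p q : ℤ, F [] p q = 1)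
    (w : List A) (hw : 0 < w.length) (p q : ℤ)
    (hFD : D w p q =
      ∑ i ∈ Finset.range (w.length + 1), F (w.take i) p q * D (w.drop i) (-q) p)
    (hvan : ∀ i, 0 < i → i < w.length → F (w.take i) p q = 0 ∨ D (w.drop i) (-q) p = 0) :
    F w p q = D w p q - D w (-q) p := by
  rw [sum_range_succ_eq_ends hw] at hFD
  · simp [hD0, hF0] at hFD
    rw [hFD]
    ring
  · intro i hi hi'
    rcases hvan i hi hi' with h | h <;> simp [h]

/-- If the associated family vanishes in lengths below `m`, then so does the normalized symbol,
and in lengths at most `m` the associated family is the difference of the symbol and its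
rotation. -/
theorem low_length_components {R : Type*} [CommRing R] {A : Type*}
    (D F : List A → ℤ → ℤ → R) (hD0 : ∀ p q : ℤ, D [] p q = 1)
    (hsym : ∀ w : List A, w ≠ [] → ∀ p q : ℤ, Int.gcd p q = 1 → D w p (-q) = D w (-p) q)
    (hper : ∀ w : List A, w ≠ [] → ∀ p q : ℤ, Int.gcd p q = 1 → D w p q = D w p (p + q))
    (hnorm : ∀ w : List A, w ≠ [] → D w 1 1 = 0)
    (hF0 : ∀ p q : ℤ, F [] p q = 1)
    (hFD : ∀ w : List A, ∀ p q : ℤ, Int.gcd p q = 1 →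
      D w p q = ∑ i ∈ Finset.range (w.length + 1), F (w.take i) p q * D (w.drop i) (-q) p)
    (m : ℕ)
    (hvan : ∀ w : List A, 0 < w.length → w.length < m →
      ∀ p q : ℤ, Int.gcd p q = 1 → F w p q = 0) :
    (∀ w : List A, 0 < w.length → w.length < m →
      ∀ p q : ℤ, Int.gcd p q = 1 → D w p q = 0) ∧
    (∀ w : List A, 0 < w.length → w.length ≤ m →
      ∀ p q : ℤ, Int.gcd p q = 1 → F w p q = D w p q - D w (-q) p) := by
  have hsub : ∀ w : List A, 0 < w.length → w.length ≤ m →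
      ∀ p q : ℤ, Int.gcd p q = 1 → F w p q = D w p q - D w (-q) p := by
    intro w hw hwm p q h
    refine associated_eq_sub_of_interior_vanishing D F hD0 hF0 w hw p q (hFD w p q h) ?_
    intro i hi hi'
    exact Or.inl (hvan _ (by rw [List.length_take]; omega)
      (by rw [List.length_take]; omega) p q h)
  refine ⟨fun w hw hwm p q h => ?_, hsub⟩
  have hne : w ≠ [] := List.length_pos_iff.mp hw
  rw [eq_one_one_of_modular_invariant (D w) (hsym w hne) (hper w hne) _ p q h, hnorm w hne]
  intro p q h
  have := hsub w hw hwm.le p q h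
  rw [hvan w hw hwm p q h] at this
  exact (sub_eq_zero.mp this.symm)


/-- let `(D^w)`, `(E^w)` be normalized componentwise `R`-valued multiple
Dedekind symbols with associated families `(F^w)`, `(G^w)`, and let `m, n ≥ 1` be such
that `F^w = 0` on `U` for `0 < l(w) < m` and `G^w = 0` on `U` for `0 < l(w) < n`. Then
the product family `(DE)^w(p,q) = Σ_{w=uv} D^u(p,q)·E^v(p,q)` is a normalized
componentwise multiple Dedekind symbol, and its associated family `(H^w)` satisfies
`H^w = 0` on `U` for `0 < l(w) < min(m,n)` and `H^w = F^w + G^w` on `U` for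
`l(w) = min(m,n)`. -/
theorem product_lowest_components {R : Type*} [CommRing R] {A : Type*}
    (D F E G : List A → ℤ → ℤ → R)
    -- D is a normalized multiple Dedekind symbol with associated family F
    (hD0 : ∀ p q : ℤ, D [] p q = 1)
    (hDsym : ∀ w : List A, w ≠ [] → ∀ p q : ℤ, Int.gcd p q = 1 → D w p (-q) = D w (-p) q)
    (hDper : ∀ w : List A, w ≠ [] → ∀ p q : ℤ, Int.gcd p q = 1 → D w p q = D w p (p + q))
    (hDnorm : ∀ w : List A, w ≠ [] → D w 1 1 = 0)
    (hF0 : ∀ p q : ℤ, F [] p q = 1)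
    (hFD : ∀ w : List A, ∀ p q : ℤ, Int.gcd p q = 1 →
      D w p q = ∑ i ∈ Finset.range (w.length + 1),
        F (w.take i) p q * D (w.drop i) (-q) p)
    -- E is a normalized multiple Dedekind symbol with associated family G
    (hE0 : ∀ p q : ℤ, E [] p q = 1)
    (hEsym : ∀ w : List A, w ≠ [] → ∀ p q : ℤ, Int.gcd p q = 1 → E w p (-q) = E w (-p) q)
    (hEper : ∀ w : List A, w ≠ [] → ∀ p q : ℤ, Int.gcd p q = 1 → E w p q = E w p (p + q))
    (hEnorm : ∀ w : List A, w ≠ [] → E w 1 1 = 0)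
    (hG0 : ∀ p q : ℤ, G [] p q = 1)
    (hGE : ∀ w : List A, ∀ p q : ℤ, Int.gcd p q = 1 →
      E w p q = ∑ i ∈ Finset.range (w.length + 1),
        G (w.take i) p q * E (w.drop i) (-q) p)
    -- vanishing of low-length components
    (m n : ℕ) (hm : 1 ≤ m) (hn : 1 ≤ n)
    (hFvan : ∀ w : List A, 0 < w.length → w.length < m →
      ∀ p q : ℤ, Int.gcd p q = 1 → F w p q = 0)
    (hGvan : ∀ w : List A, 0 < w.length → w.length < n →
      ∀ p q : ℤ, Int.gcd p q = 1 → G w p q = 0) :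
    -- DE is the product family, H its associated family
    ∀ DE : List A → ℤ → ℤ → R,
      (∀ w : List A, ∀ p q : ℤ, DE w p q =
        ∑ i ∈ Finset.range (w.length + 1), D (w.take i) p q * E (w.drop i) p q) →
    ∀ H : List A → ℤ → ℤ → R,
      (∀ p q : ℤ, H [] p q = 1) →
      (∀ w : List A, ∀ p q : ℤ, Int.gcd p q = 1 →
        DE w p q = ∑ i ∈ Finset.range (w.length + 1),
          H (w.take i) p q * DE (w.drop i) (-q) p) →
      ((∀ p q : ℤ, DE [] p q = 1) ∧
       (∀ w : List A, w ≠ [] → ∀ p q : ℤ, Int.gcd p q = 1 → DE w p (-q) = DE w (-p) q) ∧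
       (∀ w : List A, w ≠ [] → ∀ p q : ℤ, Int.gcd p q = 1 → DE w p q = DE w p (p + q)) ∧
       (∀ w : List A, w ≠ [] → DE w 1 1 = 0) ∧
       (∀ w : List A, 0 < w.length → w.length < min m n →
         ∀ p q : ℤ, Int.gcd p q = 1 → H w p q = 0) ∧
       (∀ w : List A, w.length = min m n →
         ∀ p q : ℤ, Int.gcd p q = 1 → H w p q = F w p q + G w p q)) := by
  intro DE hDE H hH0 hH
  obtain ⟨hDvan, hFsub⟩ :=
    low_length_components D F hD0 hDsym hDper hDnorm hF0 hFD m hFvan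
  obtain ⟨hEvan, hGsub⟩ :=
    low_length_components E G hE0 hEsym hEper hEnorm hG0 hGE n hGvan
  have lift : ∀ (S : List A → ℤ → ℤ → R), (∀ p q : ℤ, S [] p q = 1) →
      ∀ p q p' q' : ℤ, (∀ w, w ≠ [] → S w p q = S w p' q') → ∀ w, S w p q = S w p' q' := by
    intro S hS p q p' q' h w
    by_cases hw : w = []
    · rw [hw, hS, hS]
    · exact h w hw
  have hDE0 : ∀ p q : ℤ, DE [] p q = 1 := fun p q => by simp [hDE, hD0, hE0]
  have hDEadd : ∀ w : List A, 0 < w.length → w.length ≤ min m n →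
      ∀ p q : ℤ, Int.gcd p q = 1 → DE w p q = D w p q + E w p q := by
    intro w hw hwk p q h
    rw [hDE, sum_range_succ_eq_ends hw]
    · simp [hD0, hE0, add_comm]
    · intro i hi hi'
      rw [hDvan _ (by rw [List.length_take]; omega) (by rw [List.length_take]; omega) p q h,
        zero_mul]
  have hDEvan : ∀ w : List A, 0 < w.length → w.length < min m n →
      ∀ p q : ℤ, Int.gcd p q = 1 → DE w p q = 0 := by
    intro w hw hwk p q h
    rw [hDEadd w hw hwk.le p q h, hDvan w hw (by omega) p q h, hEvan w hw (by omega) p q h,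
      add_zero]
  have hrot : ∀ p q : ℤ, Int.gcd p q = 1 → Int.gcd (-q) p = 1 := fun p q h => by
    rwa [Int.neg_gcd, Int.gcd_comm]
  have hHadd : ∀ w : List A, 0 < w.length → w.length ≤ min m n →
      ∀ p q : ℤ, Int.gcd p q = 1 → H w p q = F w p q + G w p q := by
    intro w hw hwk p q h
    rw [associated_eq_sub_of_interior_vanishing DE H hDE0 hH0 w hw p q (hH w p q h),
      hDEadd w hw hwk p q h, hDEadd w hw hwk _ _ (hrot p q h),
      hFsub w hw (by omega) p q h, hGsub w hw (by omega) p q h]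
    · ring
    · intro i hi hi'
      exact Or.inr (hDEvan _ (by rw [List.length_drop]; omega)
        (by rw [List.length_drop]; omega) _ _ (hrot p q h))
  refine ⟨hDE0, fun w _ p q h => ?_, fun w _ p q h => ?_, fun w hw => ?_,
    fun w hw hwk p q h => ?_, fun w hwk p q h => hHadd w (by omega) hwk.le p q h⟩
  · rw [hDE, hDE]
    refine Finset.sum_congr rfl fun i _ => ?_
    rw [lift D hD0 _ _ _ _ (fun w hw => hDsym w hw p q h),
      lift E hE0 _ _ _ _ (fun w hw => hEsym w hw p q h)]
  · rw [hDE, hDE]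
    refine Finset.sum_congr rfl fun i _ => ?_
    rw [lift D hD0 _ _ _ _ (fun w hw => hDper w hw p q h),
      lift E hE0 _ _ _ _ (fun w hw => hEper w hw p q h)]
  · rw [hDE]
    refine Finset.sum_eq_zero fun i _ => ?_
    rcases Nat.eq_zero_or_pos i with rfl | hi
    · rw [List.drop_zero, hEnorm w hw, mul_zero]
    · rw [hDnorm (w.take i) (by simp [hw]; omega), zero_mul]
  · rw [hHadd w hw hwk.le p q h, hFvan w hw (by omega) p q h, hGvan w hw (by omega) p q h,
      add_zero]
end

section
/- Let R be a commutative ℚ-algebra, A a set, and for each a ∈ A let F_a : U → R be an additively-written R-valued reciprocity function (i.e. F_a(p,-q) = F_a(-p,q), F_a(p,q) + F_a(-q,p) = 0, and F_a(p,p+q) + F_a(p+q,q) = F_a(p,q) for all (p,q) ∈ U). Then there exists a componentwise R-valued multiple reciprocity function (F^w) whose component at each one-letter word a ∈ A equals F_a. -/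
/-- The concatenation product of two functions on words. -/
def wordConv {R A : Type*} [CommRing R] (f g : List A → R) (w : List A) : R :=
  ∑ i ∈ Finset.range (w.length + 1), f (w.take i) * g (w.drop i)

namespace wordConv

variable {R A : Type*} [CommRing R]

theorem nil (f g : List A → R) : wordConv f g [] = f [] * g [] := by
  simp [wordConv]

theorem cons (f g : List A → R) (a : A) (w : List A) :
    wordConv f g (a :: w) = f [] * g (a :: w) + wordConv (fun u => f (a :: u)) g w := by
  rw [wordConv, List.length_cons, Finset.sum_range_succ', add_comm]
  simp [wordConv]

theorem smul_add_left (r : R) (f f' g : List A → R) (w : List A) :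
    wordConv (fun u => r * f u + f' u) g w = r * wordConv f g w + wordConv f' g w := by
  simp only [wordConv, Finset.mul_sum, ← Finset.sum_add_distrib]
  exact Finset.sum_congr rfl fun i _ => by ring

theorem assoc (f g h : List A → R) (w : List A) :
    wordConv (wordConv f g) h w = wordConv f (wordConv g h) w := by
  induction w generalizing f with
  | nil => simp only [nil, mul_assoc]
  | cons a w ih =>
    simp only [cons, nil, smul_add_left, ih]
    ring

end wordConv

/-- Functions on words with value `1` at the empty word, i.e. noncommutative formal power series
with constant term `1`. -/
@[ext]
structure UnitWordSeries (R A : Type*) [CommRing R] where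
  /-- The coefficients. -/
  val : List A → R
  val_nil : val [] = 1

namespace UnitWordSeries

variable {R A : Type*} [CommRing R]

/-- The right inverse of a series with constant term `1`, by recursion on the length of words. -/
def invFun (f : List A → R) : List A → R
  | [] => 1
  | a :: w => -∑ i ∈ Finset.range (w.length + 1), f (a :: w.take i) * invFun f (w.drop i)
termination_by w => w.length
decreasing_by simp

theorem invFun_cons (f : List A → R) (a : A) (w : List A) :
    invFun f (a :: w) = -wordConv (fun u => f (a :: u)) (invFun f) w := by
  rw [invFun, wordConv]

noncomputable instance : Mul (UnitWordSeries R A) :=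
  ⟨fun f g => ⟨wordConv f.val g.val, by rw [wordConv.nil, f.val_nil, g.val_nil, one_mul]⟩⟩

noncomputable instance : One (UnitWordSeries R A) :=
  ⟨⟨fun w => if w.isEmpty then 1 else 0, rfl⟩⟩

noncomputable instance : Inv (UnitWordSeries R A) :=
  ⟨fun f => ⟨invFun f.val, by rw [invFun]⟩⟩

theorem mul_val (f g : UnitWordSeries R A) : (f * g).val = wordConv f.val g.val := rfl

theorem one_nil : (1 : UnitWordSeries R A).val [] = 1 := rfl

theorem one_cons (a : A) (w : List A) : (1 : UnitWordSeries R A).val (a :: w) = 0 := rfl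

noncomputable instance : Group (UnitWordSeries R A) :=
  Group.ofRightAxioms
    (fun f g h => UnitWordSeries.ext (funext fun w => wordConv.assoc f.val g.val h.val w))
    (fun f => by
      refine UnitWordSeries.ext (funext fun w => ?_)
      rw [mul_val]
      generalize f.val = g
      induction w generalizing g with
      | nil => rw [wordConv.nil, one_nil, mul_one]
      | cons a w ih => rw [wordConv.cons, one_cons, mul_zero, zero_add, ih])
    (fun f => by
      refine UnitWordSeries.ext (funext fun w => ?_)
      change wordConv f.val (invFun f.val) w = _
      cases w with
      | nil => rw [wordConv.nil, f.val_nil, invFun, one_nil, mul_one]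
      | cons a w => rw [wordConv.cons, f.val_nil, invFun_cons, one_cons, one_mul, neg_add_cancel])

/-- The linear part of a series with constant term `1`. -/
noncomputable def linearPart : UnitWordSeries R A →* Multiplicative (A → R) where
  toFun f := Multiplicative.ofAdd fun a => f.val [a]
  map_one' := rfl
  map_mul' f g := by
    rw [← ofAdd_add]
    congr 1
    funext a
    rw [mul_val, wordConv.cons, wordConv.nil, f.val_nil, g.val_nil, one_mul, mul_one, add_comm, Pi.add_apply]

theorem linearPart_surjective :
    Function.Surjective (linearPart : UnitWordSeries R A →* Multiplicative (A → R)) := by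
  intro h
  refine ⟨⟨fun w => match w with
    | [] => 1
    | a :: _ => h.toAdd a, rfl⟩, rfl⟩

end UnitWordSeries

/-- A reciprocity function on coprime pairs of integers with values in a group. -/
structure IsReciprocity {G : Type*} [Group G] (f : ℤ → ℤ → G) : Prop where
  neg_right : ∀ p q : ℤ, Int.gcd p q = 1 → f p (-q) = f (-p) q
  mul_rotate : ∀ p q : ℤ, Int.gcd p q = 1 → f p q * f (-q) p = 1
  three_term : ∀ p q : ℤ, Int.gcd p q = 1 → f p (p + q) * f (p + q) q = f p q

namespace IsReciprocity

section Basic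

variable {G : Type*} [Group G] {f : ℤ → ℤ → G}

theorem neg_neg (hf : IsReciprocity f) {p q : ℤ} (h : Int.gcd p q = 1) :
    f (-p) (-q) = f p q := by
  rw [hf.neg_right (-p) q (by simpa using h), _root_.neg_neg]

theorem one_one (hf : IsReciprocity f) : f 1 1 = 1 := by
  simpa using hf.three_term 1 0 (by simp)

theorem rotate_eq_inv (hf : IsReciprocity f) {p q : ℤ} (h : Int.gcd p q = 1) :
    f (-q) p = (f p q)⁻¹ :=
  (inv_eq_of_mul_eq_one_right (hf.mul_rotate p q h)).symm

end Basic

section Lift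

variable {G H : Type*} [Group G] [Group H]

/-- The solution of the three-term relation on positive pairs with prescribed values on the
pairs `p < q`. -/
def posLift (g : ℕ → ℕ → G) (p q : ℕ) : G :=
  if p = 0 ∨ q = 0 then 1
  else if p < q then g p q
  else if q < p then (g (p - q) p)⁻¹ * posLift g (p - q) q
  else 1
termination_by p
decreasing_by omega

theorem posLift_self (g : ℕ → ℕ → G) (p : ℕ) : posLift g p p = 1 := by
  rw [posLift]; simp

theorem posLift_of_lt (g : ℕ → ℕ → G) {p q : ℕ} (hp : 0 < p) (h : p < q) :
    posLift g p q = g p q := by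
  rw [posLift, if_neg (by omega), if_pos h]

theorem posLift_add_left (g : ℕ → ℕ → G) {p q : ℕ} (hp : 0 < p) (hq : 0 < q) :
    posLift g (p + q) q = (g p (p + q))⁻¹ * posLift g p q := by
  rw [posLift, if_neg (by omega), if_neg (by omega), if_pos (by omega), Nat.add_sub_cancel]

theorem posLift_three_term (g : ℕ → ℕ → G) {p q : ℕ} (hp : 0 < p) (hq : 0 < q) :
    posLift g p (p + q) * posLift g (p + q) q = posLift g p q := by
  rw [posLift_add_left g hp hq, posLift_of_lt g hp (by omega), mul_inv_cancel_left]

theorem map_posLift {f : ℤ → ℤ → H} (hf : IsReciprocity f) (π : G →* H) (g : ℕ → ℕ → G)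
    (hg : ∀ p q, π (g p q) = f p q) (p q : ℕ) (hp : 0 < p) (hq : 0 < q)
    (h : Nat.gcd p q = 1) : π (posLift g p q) = f p q := by
  induction p using Nat.strong_induction_on with
  | _ p ih =>
    rcases lt_trichotomy p q with hlt | rfl | hlt
    · rw [posLift_of_lt g hp hlt, hg]
    · obtain rfl : p = 1 := by simpa using h
      rw [posLift_self, map_one, Nat.cast_one, hf.one_one]
    · obtain ⟨m, rfl⟩ := Nat.exists_eq_add_of_lt hlt
      obtain ⟨r, hr, hr0⟩ : ∃ r, q + m + 1 = r + q ∧ 0 < r := ⟨m + 1, by omega, by omega⟩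
      rw [hr] at h ih ⊢
      have h' : Nat.gcd r q = 1 := by simpa using h
      rw [posLift_add_left g hr0 hq, map_mul, map_inv, hg, ih r (by omega) hr0 h',
        ← hf.three_term r q (by simpa using h')]
      push_cast
      rw [inv_mul_cancel_left]

/-- The extension of a function on positive pairs to pairs of integers by the sign and inversion
relations, with value `c` at infinity. -/
def signExtend (c : G) (E : ℕ → ℕ → G) (p q : ℤ) : G :=
  if p = 0 then c⁻¹
  else if q = 0 then c
  else if 0 < p * q then E p.natAbs q.natAbs
  else (E q.natAbs p.natAbs)⁻¹

variable (c : G) (E : ℕ → ℕ → G)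

theorem signExtend_zero_left (q : ℤ) : signExtend c E 0 q = c⁻¹ := by simp [signExtend]

theorem signExtend_zero_right {p : ℤ} (hp : p ≠ 0) : signExtend c E p 0 = c := by
  simp [signExtend, hp]

theorem signExtend_neg_right (p q : ℤ) : signExtend c E p (-q) = signExtend c E (-p) q := by
  simp [signExtend]

theorem signExtend_neg_neg (p q : ℤ) : signExtend c E (-p) (-q) = signExtend c E p q := by
  simp [signExtend]

theorem signExtend_natCast {p q : ℕ} (hp : 0 < p) (hq : 0 < q) :
    signExtend c E p q = E p q := by
  have : (0 : ℤ) < p * q := by positivity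
  simp [signExtend, this, hp.ne', hq.ne']

theorem signExtend_natCast_neg {p q : ℕ} (hp : 0 < p) (hq : 0 < q) :
    signExtend c E p (-q) = (E q p)⁻¹ := by
  have : ¬ (0 : ℤ) < p * -q := by
    have : (0 : ℤ) < p * q := by positivity
    linarith
  simp only [signExtend, this]
  simp [hp.ne', hq.ne']

/-- Cases for a pair of integers up to a common sign. -/
theorem int_pair_cases {P : ℤ → ℤ → Prop} (neg : ∀ p q, P p q → P (-p) (-q))
    (zero_left : ∀ q : ℕ, P 0 q) (zero_right : ∀ p : ℕ, P p 0)
    (pos : ∀ p q : ℕ, 0 < p → 0 < q → P p q)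
    (pos_neg : ∀ p q : ℕ, 0 < p → 0 < q → P p (-q)) (p q : ℤ) : P p q := by
  have key : ∀ (p : ℕ) (q : ℤ), P p q := by
    intro p q
    obtain ⟨n, rfl | rfl⟩ := q.eq_nat_or_neg <;> rcases p.eq_zero_or_pos with rfl | hp <;>
      rcases n.eq_zero_or_pos with rfl | hn
    · exact zero_left 0
    · exact zero_left n
    · exact zero_right p
    · exact pos p n hp hn
    · exact zero_left 0
    · simpa using neg _ _ (zero_left n)
    · simpa using zero_right p
    · exact pos_neg p n hp hn
  obtain ⟨n, rfl | rfl⟩ := p.eq_nat_or_neg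
  · exact key n q
  · simpa using neg _ _ (key n (-q))

theorem signExtend_isReciprocity (h1 : E 1 1 = 1)
    (hE : ∀ p q : ℕ, 0 < p → 0 < q → E p (p + q) * E (p + q) q = E p q) :
    IsReciprocity (signExtend c E) where
  neg_right p q _ := signExtend_neg_right c E p q
  mul_rotate := by
    intro p q
    induction p, q using int_pair_cases with
    | neg p q ih =>
      intro h
      rw [signExtend_neg_neg, signExtend_neg_neg]
      exact ih (by simpa using h)
    | zero_left q =>
      intro h
      obtain rfl : q = 1 := by simpa using h
      rw [signExtend_zero_left, signExtend_zero_right _ _ (by simp), inv_mul_cancel]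
    | zero_right p =>
      intro h
      obtain rfl : p = 1 := by simpa using h
      rw [neg_zero, signExtend_zero_left, signExtend_zero_right _ _ (by simp), mul_inv_cancel]
    | pos p q hp hq =>
      intro _
      rw [← signExtend_neg_right, signExtend_natCast _ _ hp hq, signExtend_natCast_neg _ _ hq hp,
        mul_inv_cancel]
    | pos_neg p q hp hq =>
      intro _
      rw [_root_.neg_neg, signExtend_natCast _ _ hq hp, signExtend_natCast_neg _ _ hp hq,
        inv_mul_cancel]
  three_term := by
    have h11 : signExtend c E 1 1 = 1 := by
      simpa [h1] using signExtend_natCast c E one_pos one_pos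
    intro p q
    induction p, q using int_pair_cases with
    | neg p q ih =>
      intro h
      rw [← neg_add, signExtend_neg_neg, signExtend_neg_neg, signExtend_neg_neg]
      exact ih (by simpa using h)
    | zero_left q =>
      intro h
      obtain rfl : q = 1 := by simpa using h
      simp [signExtend_zero_left, h11]
    | zero_right p =>
      intro h
      obtain rfl : p = 1 := by simpa using h
      simp [h11]
    | pos p q hp hq =>
      intro _
      rw [← Nat.cast_add, signExtend_natCast _ _ hp (by omega),
        signExtend_natCast _ _ (by omega) hq, signExtend_natCast _ _ hp hq, hE p q hp hq]
    | pos_neg p q hp hq =>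
      intro h
      rcases lt_trichotomy p q with hlt | rfl | hlt
      · obtain ⟨m, rfl⟩ := Nat.exists_eq_add_of_lt hlt
        have e : (p : ℤ) + -((p + m + 1 : ℕ) : ℤ) = -((m + 1 : ℕ) : ℤ) := by push_cast; ring
        have hm := hE (m + 1) p (by omega) hp
        rw [show m + 1 + p = p + m + 1 by omega] at hm
        rw [e, signExtend_neg_neg, signExtend_natCast_neg _ _ hp (by omega),
          signExtend_natCast_neg _ _ hp (by omega), signExtend_natCast _ _ (by omega) (by omega),
          ← hm]
        group
      · obtain rfl : p = 1 := by simpa using h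
        rw [signExtend_natCast_neg _ _ hp hp, Nat.cast_one, add_neg_cancel, signExtend_zero_left,
          signExtend_zero_right _ _ one_ne_zero, h1, mul_inv_cancel, inv_one]
      · obtain ⟨m, rfl⟩ := Nat.exists_eq_add_of_lt hlt
        have e : ((q + m + 1 : ℕ) : ℤ) + -(q : ℤ) = ((m + 1 : ℕ) : ℤ) := by push_cast; ring
        have hm := hE q (m + 1) hq (by omega)
        rw [← add_assoc] at hm
        rw [e, signExtend_natCast_neg _ _ hp hq, signExtend_natCast_neg _ _ (by omega) hq,
          signExtend_natCast _ _ hp (by omega), ← hm]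
        group

theorem map_signExtend {f : ℤ → ℤ → H} (hf : IsReciprocity f) (π : G →* H) (hc : π c = f 1 0)
    (hE : ∀ p q : ℕ, 0 < p → 0 < q → Nat.gcd p q = 1 → π (E p q) = f p q) (p q : ℤ) :
    Int.gcd p q = 1 → π (signExtend c E p q) = f p q := by
  induction p, q using int_pair_cases with
  | neg p q ih =>
    intro h
    have h' : Int.gcd p q = 1 := by simpa using h
    rw [signExtend_neg_neg, hf.neg_neg h', ih h']
  | zero_left q =>
    intro h
    obtain rfl : q = 1 := by simpa using h
    have := hf.rotate_eq_inv (p := 1) (q := 0) (by simp)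
    rw [signExtend_zero_left, map_inv, hc, ← this, neg_zero, Nat.cast_one]
  | zero_right p =>
    intro h
    obtain rfl : p = 1 := by simpa using h
    rw [signExtend_zero_right _ _ (by simp), hc, Nat.cast_one]
  | pos p q hp hq =>
    intro h
    rw [signExtend_natCast _ _ hp hq, hE p q hp hq (by simpa using h)]
  | pos_neg p q hp hq =>
    intro h
    have h' : Nat.gcd q p = 1 := by simpa [Nat.gcd_comm] using h
    have h'' : Int.gcd q p = 1 := by simpa using h'
    rw [signExtend_natCast_neg _ _ hp hq, map_inv, hE q p hq hp h', ← hf.rotate_eq_inv h'',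
      hf.neg_right p q (by simpa using h)]

/-- Reciprocity functions lift along surjective group homomorphisms. -/
theorem exists_lift {f : ℤ → ℤ → H} (hf : IsReciprocity f) (π : G →* H)
    (hπ : Function.Surjective π) :
    ∃ F : ℤ → ℤ → G, IsReciprocity F ∧ ∀ p q : ℤ, Int.gcd p q = 1 → π (F p q) = f p q := by
  choose s hs using hπ
  let g : ℕ → ℕ → G := fun p q => s (f p q)
  refine ⟨signExtend (s (f 1 0)) (posLift g),
    signExtend_isReciprocity _ _ (posLift_self g 1) fun p q => posLift_three_term g,
    map_signExtend _ _ hf π (hs _) (map_posLift hf π g fun p q => hs _)⟩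

end Lift

end IsReciprocity


/-- let `R` be a commutative `ℚ`-algebra, `A` a set, and for each `a ∈ A`
let `Fa a : U → R` be an (additively written) `R`-valued reciprocity function. Then there
is a componentwise `R`-valued multiple reciprocity function `(F^w)` whose component at
each one-letter word `a` equals `Fa a` on `U`. -/
theorem exists_multiple_reciprocity_with_given_length_one {R : Type*} [CommRing R]
    [Algebra ℚ R] {A : Type*} (Fa : A → ℤ → ℤ → R)
    (hsym : ∀ a : A, ∀ p q : ℤ, Int.gcd p q = 1 → Fa a p (-q) = Fa a (-p) q)
    (hinv : ∀ a : A, ∀ p q : ℤ, Int.gcd p q = 1 → Fa a p q + Fa a (-q) p = 0)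
    (hrec : ∀ a : A, ∀ p q : ℤ, Int.gcd p q = 1 →
      Fa a p (p + q) + Fa a (p + q) q = Fa a p q) :
    ∃ F : List A → ℤ → ℤ → R,
      (∀ p q : ℤ, F [] p q = 1) ∧
      (∀ w : List A, w ≠ [] → ∀ p q : ℤ, Int.gcd p q = 1 → F w p (-q) = F w (-p) q) ∧
      (∀ w : List A, w ≠ [] → ∀ p q : ℤ, Int.gcd p q = 1 →
        ∑ i ∈ Finset.range (w.length + 1), F (w.take i) p q * F (w.drop i) (-q) p = 0) ∧
      (∀ w : List A, w ≠ [] → ∀ p q : ℤ, Int.gcd p q = 1 →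
        ∑ i ∈ Finset.range (w.length + 1),
          F (w.take i) p (p + q) * F (w.drop i) (p + q) q = F w p q) ∧
      (∀ a : A, ∀ p q : ℤ, Int.gcd p q = 1 → F [a] p q = Fa a p q) := by
  have hf : IsReciprocity fun p q : ℤ => Multiplicative.ofAdd fun a => Fa a p q :=
    ⟨fun p q h => congrArg _ (funext fun a => hsym a p q h),
      fun p q h => congrArg Multiplicative.ofAdd (funext fun a => hinv a p q h),
      fun p q h => congrArg Multiplicative.ofAdd (funext fun a => hrec a p q h)⟩
  obtain ⟨F, hF, hlin⟩ :=
    hf.exists_lift UnitWordSeries.linearPart UnitWordSeries.linearPart_surjective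
  refine ⟨fun w p q => (F p q).val w, fun p q => (F p q).val_nil, fun w _ p q h => ?_,
    fun w hw p q h => ?_, fun w _ p q h => ?_, fun a p q h => ?_⟩
  · simp only [hF.neg_right p q h]
  · obtain ⟨a, v, rfl⟩ := List.exists_cons_of_ne_nil hw
    exact congrFun (congrArg UnitWordSeries.val (hF.mul_rotate p q h)) (a :: v)
  · exact congrFun (congrArg UnitWordSeries.val (hF.three_term p q h)) w
  · exact congrFun (congrArg Multiplicative.toAdd (hlin p q h)) a
end

section
/- Let (D^w) be a componentwise R-valued multiple Dedekind symbol with associated family (F^w). Then for all nonempty words u, v and all (p,q) ∈ U: Σ_{w ∈ Sh(u,v)} D^w(p,q) = Σ_{u=u₁u₂, v=v₁v₂} ( Σ_{w₁ ∈ Sh(u₁,v₁)} F^{w₁}(p,q) ) · ( Σ_{w₂ ∈ Sh(u₂,v₂)} D^{w₂}(-q,p) ), where the outer sum runs over all splittings of u and of v into a prefix and a suffix, and all shuffle sums are counted with multiplicity. -/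
namespace Stmt15

/-- The multiset of shuffles of two words: `Sh(∅,v) = {v}`, `Sh(u,∅) = {u}`,
`Sh(a::u, b::v) = a::Sh(u, b::v) + b::Sh(a::u, v)` (multisets added with multiplicity). -/
def Sh {A : Type*} : List A → List A → Multiset (List A)
  | [], v => {v}
  | u, [] => {u}
  | a :: u, b :: v => ((Sh u (b :: v)).map (a :: ·)) + ((Sh (a :: u) v).map (b :: ·))
  termination_by u v => u.length + v.length

theorem Sh_nil_left {A : Type*} (v : List A) : Sh [] v = {v} := by
  rw [Sh]

theorem Sh_nil_right {A : Type*} (u : List A) : Sh u [] = {u} := by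
  cases u <;> simp [Sh]

theorem Sh_cons_cons {A : Type*} (a b : A) (u v : List A) :
    Sh (a :: u) (b :: v) =
      (Sh u (b :: v)).map (a :: ·) + (Sh (a :: u) v).map (b :: ·) := by
  rw [Sh]

/-- The sum of `G w₁ w₂` over the splittings `w = w₁w₂` into a prefix and a suffix. -/
def sumSplittings {A M : Type*} [AddCommMonoid M] (G : List A → List A → M) (w : List A) : M :=
  ∑ i ∈ Finset.range (w.length + 1), G (w.take i) (w.drop i)

theorem sumSplittings_cons {A M : Type*} [AddCommMonoid M] (G : List A → List A → M)
    (a : A) (w : List A) :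
    sumSplittings G (a :: w) = sumSplittings (fun w₁ => G (a :: w₁)) w + G [] (a :: w) := by
  simp only [sumSplittings, List.length_cons]
  rw [Finset.sum_range_succ']
  simp

/-- Deconcatenation is compatible with shuffles: splitting all shuffles of `u` and `v` amounts
to shuffling the prefixes and the suffixes of `u` and `v` independently. -/
theorem sum_map_sumSplittings_Sh {A M : Type*} [AddCommMonoid M] :
    ∀ (u v : List A) (G : List A → List A → M),
      ((Sh u v).map (sumSplittings G)).sum =
        ∑ i ∈ Finset.range (u.length + 1), ∑ j ∈ Finset.range (v.length + 1),
          ((Sh (u.take i) (v.take j)).map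
            (fun w₁ => ((Sh (u.drop i) (v.drop j)).map (G w₁)).sum)).sum
  | [], v, G => by simp [Sh_nil_left, sumSplittings]
  | a :: u, [], G => by simp [Sh_nil_right, sumSplittings]
  | a :: u, b :: v, G => by
    have hu := sum_map_sumSplittings_Sh u (b :: v) (fun w₁ => G (a :: w₁))
    have hv := sum_map_sumSplittings_Sh (a :: u) v (fun w₁ => G (b :: w₁))
    rw [Sh_cons_cons]
    simp only [Multiset.map_add, Multiset.sum_add, Multiset.map_map, Function.comp_def,
      sumSplittings_cons, Multiset.sum_map_add, hu, hv]
    simp only [List.length_cons, Finset.sum_range_succ' _ (_ + 1), List.take_succ_cons,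
      List.drop_succ_cons, List.take_zero, List.drop_zero, Sh_nil_left, Sh_nil_right,
      Sh_cons_cons, Multiset.map_add, Multiset.sum_add, Multiset.map_map, Function.comp_def,
      Multiset.map_singleton, Multiset.sum_singleton, Finset.sum_add_distrib]
    abel
  termination_by u v => u.length + v.length

/-- shuffle decomposition: for a componentwise `R`-valued multiple
Dedekind symbol `(D^w)` with associated family `(F^w)`, for all nonempty words `u, v`
and `(p,q) ∈ U`:
`Σ_{w∈Sh(u,v)} D^w(p,q) = Σ_{u=u₁u₂, v=v₁v₂} (Σ_{w₁∈Sh(u₁,v₁)} F^{w₁}(p,q)) ·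
(Σ_{w₂∈Sh(u₂,v₂)} D^{w₂}(-q,p))`. -/
theorem shuffle_decomposition {R : Type*} [CommRing R] {A : Type*}
    (D F : List A → ℤ → ℤ → R)
    (hD0 : ∀ p q : ℤ, D [] p q = 1)
    (hDsym : ∀ w : List A, w ≠ [] → ∀ p q : ℤ, Int.gcd p q = 1 → D w p (-q) = D w (-p) q)
    (hDper : ∀ w : List A, w ≠ [] → ∀ p q : ℤ, Int.gcd p q = 1 → D w p q = D w p (p + q))
    (hF0 : ∀ p q : ℤ, F [] p q = 1)
    (hFD : ∀ w : List A, ∀ p q : ℤ, Int.gcd p q = 1 →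
      D w p q = ∑ i ∈ Finset.range (w.length + 1),
        F (w.take i) p q * D (w.drop i) (-q) p) :
    ∀ u v : List A, u ≠ [] → v ≠ [] → ∀ p q : ℤ, Int.gcd p q = 1 →
      ((Sh u v).map (fun w => D w p q)).sum =
        ∑ i ∈ Finset.range (u.length + 1), ∑ j ∈ Finset.range (v.length + 1),
          ((Sh (u.take i) (v.take j)).map (fun w₁ => F w₁ p q)).sum *
            ((Sh (u.drop i) (v.drop j)).map (fun w₂ => D w₂ (-q) p)).sum := by
  intro u v _ _ p q hpq
  have hD : (fun w => D w p q) = sumSplittings (fun w₁ w₂ => F w₁ p q * D w₂ (-q) p) :=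
    funext fun w => hFD w p q hpq
  rw [hD, sum_map_sumSplittings_Sh]
  simp only [Multiset.sum_map_mul_left, Multiset.sum_map_mul_right]

end Stmt15
end

section
/- Let (D^w) be a normalized componentwise R-valued multiple Dedekind symbol with associated family (F^w). Then (D^w) is shuffled if and only if (F^w) is shuffled. -/
namespace Stmt16

/-- The multiset of shuffles of two words: `Sh(∅,v) = {v}`, `Sh(u,∅) = {u}`,
`Sh(a::u, b::v) = a::Sh(u, b::v) + b::Sh(a::u, v)` (multisets added with multiplicity). -/
def Sh {A : Type*} : List A → List A → Multiset (List A)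
  | [], v => {v}
  | u, [] => {u}
  | a :: u, b :: v => ((Sh u (b :: v)).map (a :: ·)) + ((Sh (a :: u) v).map (b :: ·))
  termination_by u v => u.length + v.length

/-- A family `(X^w)` of functions indexed by words is shuffled if
`X^u(p,q)·X^v(p,q) = Σ_{w∈Sh(u,v)} X^w(p,q)` (with multiplicity) on `U`. -/
def Shuffled {R : Type*} [CommRing R] {A : Type*} (X : List A → ℤ → ℤ → R) : Prop :=
  ∀ u v : List A, ∀ p q : ℤ, Int.gcd p q = 1 →
    X u p q * X v p q = ((Sh u v).map (fun w => X w p q)).sum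

/-- The sum of `φ` over the shuffles of `u` and `v`. -/
def shuffleSum {R : Type*} [CommRing R] {A : Type*} (φ : List A → R) (u v : List A) : R :=
  ((Sh u v).map φ).sum

/-- The sum of `K x y` over all splittings `w = x ++ y`. -/
def splitSum {R : Type*} [CommRing R] {A : Type*} (K : List A → List A → R) (w : List A) : R :=
  ∑ i ∈ Finset.range (w.length + 1), K (w.take i) (w.drop i)

/-- A function on words that is a character of the shuffle algebra, up to the unit axiom. -/
def IsShuffleChar {R : Type*} [CommRing R] {A : Type*} (f : List A → R) : Prop :=
  ∀ u v : List A, f u * f v = shuffleSum f u v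

section Words

variable {R : Type*} [CommRing R] {A : Type*}

@[simp]
theorem shuffleSum_nil_left (φ : List A → R) (v : List A) : shuffleSum φ [] v = φ v := by
  simp [shuffleSum, Sh]

@[simp]
theorem shuffleSum_nil_right (φ : List A → R) (u : List A) : shuffleSum φ u [] = φ u := by
  cases u <;> simp [shuffleSum, Sh]

theorem shuffleSum_cons_cons (φ : List A → R) (a b : A) (u v : List A) :
    shuffleSum φ (a :: u) (b :: v) =
      shuffleSum (fun w => φ (a :: w)) u (b :: v) +
        shuffleSum (fun w => φ (b :: w)) (a :: u) v := by
  simp [shuffleSum, Sh, Multiset.map_map]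

theorem shuffleSum_add (φ ψ : List A → R) (u v : List A) :
    shuffleSum (fun w => φ w + ψ w) u v = shuffleSum φ u v + shuffleSum ψ u v :=
  Multiset.sum_map_add

theorem shuffleSum_mul_left (c : R) (φ : List A → R) (u v : List A) :
    shuffleSum (fun w => c * φ w) u v = c * shuffleSum φ u v :=
  Multiset.sum_map_mul_left

theorem shuffleSum_mul_right (c : R) (φ : List A → R) (u v : List A) :
    shuffleSum (fun w => φ w * c) u v = shuffleSum φ u v * c :=
  Multiset.sum_map_mul_right

@[simp]
theorem splitSum_nil (K : List A → List A → R) : splitSum K [] = K [] [] := by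
  simp [splitSum]

theorem splitSum_cons (K : List A → List A → R) (a : A) (w : List A) :
    splitSum K (a :: w) = K [] (a :: w) + splitSum (fun x y => K (a :: x) y) w := by
  rw [splitSum, splitSum, List.length_cons, Finset.sum_range_succ', add_comm]
  simp

theorem splitSum_add (K L : List A → List A → R) (w : List A) :
    splitSum (fun x y => K x y + L x y) w = splitSum K w + splitSum L w :=
  Finset.sum_add_distrib

theorem splitSum_sub (K L : List A → List A → R) (w : List A) :
    splitSum (fun x y => K x y - L x y) w = splitSum K w - splitSum L w :=
  Finset.sum_sub_distrib _ _

theorem splitSum_mul_left (c : R) (K : List A → List A → R) (w : List A) :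
    splitSum (fun x y => c * K x y) w = c * splitSum K w :=
  (Finset.mul_sum _ _ _).symm

theorem splitSum_mul_right (c : R) (K : List A → List A → R) (w : List A) :
    splitSum (fun x y => K x y * c) w = splitSum K w * c :=
  (Finset.sum_mul _ _ _).symm

theorem splitSum_eq_last (K : List A → List A → R) (w : List A)
    (h : ∀ x y, x.length < w.length → K x y = 0) : splitSum K w = K w [] := by
  rw [splitSum, Finset.sum_range_succ, Finset.sum_eq_zero, zero_add]
  · simp
  · intro i hi
    apply h
    rw [Finset.mem_range] at hi
    simpa using hi

/-- Deconcatenation is a morphism for the shuffle product. -/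
theorem shuffleSum_splitSum (u v : List A) (K : List A → List A → R) :
    shuffleSum (splitSum K) u v =
      splitSum (fun u₁ u₂ => splitSum (fun v₁ v₂ =>
        shuffleSum (fun x => shuffleSum (K x) u₂ v₂) u₁ v₁) v) u := by
  induction u generalizing v K with
  | nil => simp
  | cons a u ihu =>
    induction v generalizing K with
    | nil => simp
    | cons b v ihv =>
      have hsplit : ∀ c : A, (fun w => splitSum K (c :: w)) =
          fun w => K [] (c :: w) + splitSum (fun x y => K (c :: x) y) w :=
        fun c => funext fun w => splitSum_cons K c w
      rw [shuffleSum_cons_cons, hsplit a, hsplit b, shuffleSum_add, shuffleSum_add, ihu, ihv]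
      simp only [splitSum_cons, shuffleSum_cons_cons, shuffleSum_nil_left, shuffleSum_nil_right,
        splitSum_add]
      ring

theorem shuffleSum_splitSum_mul (f g : List A → R) (u v : List A) :
    shuffleSum (splitSum fun x y => f x * g y) u v =
      splitSum (fun u₁ u₂ => splitSum (fun v₁ v₂ =>
        shuffleSum f u₁ v₁ * shuffleSum g u₂ v₂) v) u := by
  simp only [shuffleSum_splitSum, shuffleSum_mul_left, shuffleSum_mul_right]

theorem splitSum_mul_splitSum (f g : List A → R) (u v : List A) :
    splitSum (fun x y => f x * g y) u * splitSum (fun x y => f x * g y) v =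
      splitSum (fun u₁ u₂ => splitSum (fun v₁ v₂ =>
        f u₁ * f v₁ * (g u₂ * g v₂)) v) u := by
  rw [← splitSum_mul_right]
  simp only [← splitSum_mul_left, mul_mul_mul_comm]

theorem IsShuffleChar.convolution {f g : List A → R} (hf : IsShuffleChar f)
    (hg : IsShuffleChar g) : IsShuffleChar (splitSum fun x y => f x * g y) := by
  intro u v
  rw [shuffleSum_splitSum_mul, splitSum_mul_splitSum]
  simp only [hf _ _, hg _ _]

/-- Right cancellation of shuffle characters for the convolution product. -/
theorem IsShuffleChar.of_convolution {f g : List A → R} (hg0 : g [] = 1) (hg : IsShuffleChar g)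
    (h : IsShuffleChar (splitSum fun x y => f x * g y)) : IsShuffleChar f := by
  intro u v
  induction hn : u.length + v.length using Nat.strong_induction_on generalizing u v with
  | _ n ih =>
    subst hn
    have key := h u v
    rw [shuffleSum_splitSum_mul, splitSum_mul_splitSum, ← sub_eq_zero, ← splitSum_sub] at key
    simp only [← splitSum_sub, ← hg _ _, ← sub_mul] at key
    have vanish : ∀ u₁ v₁ : List A, u₁.length + v₁.length < u.length + v.length →
        f u₁ * f v₁ - shuffleSum f u₁ v₁ = 0 :=
      fun u₁ v₁ hlt => sub_eq_zero.mpr (ih _ hlt u₁ v₁ rfl)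
    have outer : ∀ u₁ u₂ : List A, u₁.length ≤ u.length →
        splitSum (fun v₁ v₂ => (f u₁ * f v₁ - shuffleSum f u₁ v₁) * (g u₂ * g v₂)) v =
          (f u₁ * f v - shuffleSum f u₁ v) * (g u₂ * g []) := fun u₁ u₂ hu =>
      splitSum_eq_last _ _ fun v₁ v₂ hv => by rw [vanish u₁ v₁ (by omega), zero_mul]
    rw [splitSum_eq_last _ u fun u₁ u₂ hu => by
      rw [outer u₁ u₂ hu.le, vanish u₁ v (by omega), zero_mul], outer u [] le_rfl] at key
    simpa [hg0, sub_eq_zero] using key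

theorem IsShuffleChar.of_eq_zero {f : List A → R} (h0 : f [] = 1)
    (h : ∀ w, w ≠ [] → f w = 0) : IsShuffleChar f := by
  intro u v
  rcases u with _ | ⟨a, u⟩
  · simp [h0]
  rcases v with _ | ⟨b, v⟩
  · simp [h0]
  · rw [shuffleSum_cons_cons]
    simp [h, shuffleSum]

end Words

theorem shuffled_iff_isShuffleChar {R : Type*} [CommRing R] {A : Type*}
    (X : List A → ℤ → ℤ → R) :
    Shuffled X ↔ ∀ p q : ℤ, Int.gcd p q = 1 → IsShuffleChar fun w => X w p q :=
  ⟨fun h p q hpq u v => h u v p q hpq, fun h u v p q hpq => h p q hpq u v⟩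

theorem apply_emod_of_periodic {R : Type*} (f : ℤ → ℤ → R)
    (hper : ∀ p q : ℤ, Int.gcd p q = 1 → f p q = f p (p + q))
    {p q : ℤ} (hpq : Int.gcd p q = 1) : f p q = f p (q % p) := by
  have add_mul : ∀ k r : ℤ, Int.gcd p r = 1 → f p (r + k * p) = f p r := by
    intro k r hr
    induction k using Int.induction_on with
    | zero => simp
    | succ k ih =>
      rw [← ih, hper p (r + k * p) (by simpa using hr)]
      congr 1
      ring
    | pred k ih =>
      rw [← ih, hper p (r + (-k - 1) * p) (by simpa using hr)]
      congr 1
      ring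
  have hr : Int.gcd p (q % p) = 1 := by rwa [Int.gcd_comm, Int.gcd_emod, Int.gcd_comm]
  rw [← add_mul (q / p) _ hr, Int.emod_add_ediv_mul]

/-- a normalized componentwise `R`-valued multiple Dedekind symbol `(D^w)`
is shuffled if and only if its associated family `(F^w)` is shuffled. -/
theorem shuffled_iff {R : Type*} [CommRing R] {A : Type*}
    (D F : List A → ℤ → ℤ → R)
    (hD0 : ∀ p q : ℤ, D [] p q = 1)
    (hDsym : ∀ w : List A, w ≠ [] → ∀ p q : ℤ, Int.gcd p q = 1 → D w p (-q) = D w (-p) q)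
    (hDper : ∀ w : List A, w ≠ [] → ∀ p q : ℤ, Int.gcd p q = 1 → D w p q = D w p (p + q))
    (hDnorm : ∀ w : List A, w ≠ [] → D w 1 1 = 0)
    (hF0 : ∀ p q : ℤ, F [] p q = 1)
    (hFD : ∀ w : List A, ∀ p q : ℤ, Int.gcd p q = 1 →
      D w p q = ∑ i ∈ Finset.range (w.length + 1),
        F (w.take i) p q * D (w.drop i) (-q) p) :
    Shuffled D ↔ Shuffled F := by
  have hconv : ∀ p q : ℤ, Int.gcd p q = 1 →
      (fun w => D w p q) = splitSum fun x y => F x p q * D y (-q) p :=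
    fun p q hpq => funext fun w => hFD w p q hpq
  have hrot : ∀ p q : ℤ, Int.gcd p q = 1 → Int.gcd (-q) p = 1 := fun p q hpq => by
    rwa [Int.neg_gcd, Int.gcd_comm]
  rw [shuffled_iff_isShuffleChar, shuffled_iff_isShuffleChar]
  refine ⟨fun hD p q hpq => ?_, fun hF => ?_⟩
  · exact .of_convolution (g := fun w => D w (-q) p) (hD0 _ _) (hD _ _ (hrot p q hpq))
      (hconv p q hpq ▸ hD p q hpq)
  · have step : ∀ p q : ℤ, Int.gcd p q = 1 → IsShuffleChar (fun w => D w (-q) p) →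
        IsShuffleChar fun w => D w p q := fun p q hpq h =>
      hconv p q hpq ▸ (hF p q hpq).convolution h
    have one : ∀ w, w ≠ [] → ∀ q : ℤ, D w 1 q = 0 := fun w hw q => by
      rw [apply_emod_of_periodic _ (hDper w hw) (Int.one_gcd), Int.emod_one,
        hDper w hw 1 0 (by simp), add_zero, hDnorm w hw]
    have unit : ∀ p q : ℤ, p.natAbs = 1 → IsShuffleChar fun w => D w p q := by
      intro p q hp
      refine .of_eq_zero (hD0 _ _) fun w hw => ?_
      rcases Int.natAbs_eq_iff.mp hp with rfl | rfl
      · exact one w hw q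
      · exact (hDsym w hw 1 q Int.one_gcd).symm.trans (one w hw _)
    intro p
    induction hn : p.natAbs using Nat.strong_induction_on generalizing p with
    | _ n ih =>
      subst hn
      intro q hpq
      rcases eq_or_ne p 0 with rfl | hp
      · exact step 0 q hpq (unit _ _ (by simpa using hpq))
      · have hmod : (fun w => D w p q) = fun w => D w p (q % p) := by
          funext w
          rcases eq_or_ne w [] with rfl | hw
          · rw [hD0, hD0]
          · exact apply_emod_of_periodic _ (hDper w hw) hpq
        have hr : Int.gcd p (q % p) = 1 := by rwa [Int.gcd_comm, Int.gcd_emod, Int.gcd_comm]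
        rw [hmod]
        refine step p _ hr (ih _ ?_ _ rfl p (hrot _ _ hr))
        have := Int.emod_nonneg q hp
        have := Int.emod_lt q hp
        omega

end Stmt16
end

section
/- Let (D^w) and (E^w) be shuffled componentwise R-valued multiple Dedekind symbols. Then: (i) the inverse family (K^w), defined by K^∅ ≡ 1 and, for each nonempty word w, by the recursion Σ_{w=uv} D^u(p,q)·K^v(p,q) = 0, is a shuffled componentwise R-valued multiple Dedekind symbol; (ii) the product family (H^w) given by H^w(p,q) = Σ_{w=uv} D^u(p,q)·E^v(p,q) is a shuffled componentwise R-valued multiple Dedekind symbol. -/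
namespace Stmt17

/-- The multiset of shuffles of two words: `Sh(∅,v) = {v}`, `Sh(u,∅) = {u}`,
`Sh(a::u, b::v) = a::Sh(u, b::v) + b::Sh(a::u, v)` (multisets added with multiplicity). -/
def Sh {A : Type*} : List A → List A → Multiset (List A)
  | [], v => {v}
  | u, [] => {u}
  | a :: u, b :: v => ((Sh u (b :: v)).map (a :: ·)) + ((Sh (a :: u) v).map (b :: ·))
  termination_by u v => u.length + v.length

/-- A family `(X^w)` of functions indexed by words is shuffled if
`X^u(p,q)·X^v(p,q) = Σ_{w∈Sh(u,v)} X^w(p,q)` (with multiplicity) on `U`. -/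
def Shuffled {R : Type*} [CommRing R] {A : Type*} (X : List A → ℤ → ℤ → R) : Prop :=
  ∀ u v : List A, ∀ p q : ℤ, Int.gcd p q = 1 →
    X u p q * X v p q = ((Sh u v).map (fun w => X w p q)).sum

/-- A componentwise `R`-valued multiple Dedekind symbol: `X^∅ ≡ 1`, and for every
nonempty word `w`, `X^w(p,-q) = X^w(-p,q)` and `X^w(p,q) = X^w(p,p+q)` on `U`. -/
def IsMDS {R : Type*} [CommRing R] {A : Type*} (X : List A → ℤ → ℤ → R) : Prop :=
  (∀ p q : ℤ, X [] p q = 1) ∧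
  (∀ w : List A, w ≠ [] → ∀ p q : ℤ, Int.gcd p q = 1 → X w p (-q) = X w (-p) q) ∧
  (∀ w : List A, w ≠ [] → ∀ p q : ℤ, Int.gcd p q = 1 → X w p q = X w p (p + q))

/-- The sum of `F x y` over all factorizations `w = x ++ y`. -/
def splitSum {R : Type*} [AddCommMonoid R] {A : Type*} (F : List A → List A → R)
    (w : List A) : R :=
  ∑ i ∈ Finset.range (w.length + 1), F (w.take i) (w.drop i)

/-- The sum of `f` over all shuffles of `u` and `v`. -/
def shuffleSum {R : Type*} [AddCommMonoid R] {A : Type*} (u v : List A) (f : List A → R) : R :=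
  ((Sh u v).map f).sum

section AddCommMonoid

variable {R : Type*} [AddCommMonoid R] {A : Type*}

@[simp]
theorem splitSum_nil (F : List A → List A → R) : splitSum F [] = F [] [] := by
  simp [splitSum]

@[simp]
theorem splitSum_cons (F : List A → List A → R) (a : A) (w : List A) :
    splitSum F (a :: w) = F [] (a :: w) + splitSum (fun x y => F (a :: x) y) w := by
  rw [splitSum, List.length_cons, Finset.sum_range_succ', add_comm]
  rfl

theorem splitSum_add (F G : List A → List A → R) (w : List A) :
    splitSum (fun x y => F x y + G x y) w = splitSum F w + splitSum G w :=
  Finset.sum_add_distrib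

theorem splitSum_congr {F G : List A → List A → R} {w : List A}
    (h : ∀ x y, x ++ y = w → F x y = G x y) : splitSum F w = splitSum G w :=
  Finset.sum_congr rfl fun i _ => h _ _ (List.take_append_drop i w)

@[simp]
theorem shuffleSum_nil_left (v : List A) (f : List A → R) : shuffleSum [] v f = f v := by
  simp [shuffleSum, Sh]

@[simp]
theorem shuffleSum_nil_right (u : List A) (f : List A → R) : shuffleSum u [] f = f u := by
  cases u <;> simp [shuffleSum, Sh]

@[simp]
theorem shuffleSum_cons_cons (a b : A) (u v : List A) (f : List A → R) :
    shuffleSum (a :: u) (b :: v) f =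
      shuffleSum u (b :: v) (fun w => f (a :: w)) +
        shuffleSum (a :: u) v (fun w => f (b :: w)) := by
  simp [shuffleSum, Sh]

theorem shuffleSum_add (u v : List A) (f g : List A → R) :
    shuffleSum u v (fun w => f w + g w) = shuffleSum u v f + shuffleSum u v g :=
  Multiset.sum_map_add

/-- Deconcatenation is compatible with shuffles. -/
theorem shuffleSum_splitSum : ∀ (u v : List A) (F : List A → List A → R),
    shuffleSum u v (splitSum F) =
      splitSum (fun u₁ u₂ => splitSum (fun v₁ v₂ =>
        shuffleSum u₁ v₁ fun w₁ => shuffleSum u₂ v₂ (F w₁)) v) u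
  | [], v, F => by simp
  | a :: u, [], F => by simp
  | a :: u, b :: v, F => by
    simp only [shuffleSum_cons_cons, splitSum_cons, shuffleSum_add, splitSum_add,
      shuffleSum_splitSum u (b :: v), shuffleSum_splitSum (a :: u) v,
      shuffleSum_nil_left, shuffleSum_nil_right]
    abel
  termination_by u v => u.length + v.length

end AddCommMonoid

section CommRing

variable {R : Type*} [CommRing R] {A : Type*}

theorem shuffleSum_mul_shuffleSum (u v u' v' : List A) (f g : List A → R) :
    shuffleSum u v (fun w => shuffleSum u' v' fun w' => f w * g w') =
      shuffleSum u v f * shuffleSum u' v' g := by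
  simp [shuffleSum, Multiset.sum_map_mul_left, Multiset.sum_map_mul_right]

theorem splitSum_mul_splitSum (F G : List A → List A → R) (u v : List A) :
    splitSum F u * splitSum G v =
      splitSum (fun u₁ u₂ => splitSum (fun v₁ v₂ => F u₁ u₂ * G v₁ v₂) v) u :=
  Finset.sum_mul_sum ..

/-- The deconcatenation product of two functions on words. -/
def conv (f g : List A → R) : List A → R :=
  splitSum fun x y => f x * g y

/-- `f` is multiplicative for the shuffle product. -/
def IsShuffleHom (f : List A → R) : Prop :=
  ∀ u v, f u * f v = shuffleSum u v f

theorem shuffleSum_conv {f : List A → R} (hf : IsShuffleHom f) (g : List A → R) (u v : List A) :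
    shuffleSum u v (conv f g) =
      splitSum (fun u₁ u₂ => splitSum (fun v₁ v₂ =>
        f u₁ * f v₁ * shuffleSum u₂ v₂ g) v) u := by
  simp only [conv, shuffleSum_splitSum, shuffleSum_mul_shuffleSum, hf _ _]

theorem conv_mul_conv (f g : List A → R) (u v : List A) :
    conv f g u * conv f g v =
      splitSum (fun u₁ u₂ => splitSum (fun v₁ v₂ =>
        f u₁ * f v₁ * (g u₂ * g v₂)) v) u := by
  simp only [conv, splitSum_mul_splitSum, mul_mul_mul_comm]

theorem IsShuffleHom.conv {f g : List A → R} (hf : IsShuffleHom f) (hg : IsShuffleHom g) :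
    IsShuffleHom (conv f g) := fun u v => by
  simp only [shuffleSum_conv hf, conv_mul_conv, hg _ _]

theorem conv_cons (f g : List A → R) (a : A) (w : List A) :
    conv f g (a :: w) = f [] * g (a :: w) + conv (fun x => f (a :: x)) g w :=
  splitSum_cons ..

theorem shuffleSum_eq_zero (a b : A) (u v : List A) {f : List A → R}
    (hf : ∀ w, w ≠ [] → f w = 0) : shuffleSum (a :: u) (b :: v) f = 0 := by
  rw [shuffleSum_cons_cons]
  simp [shuffleSum, hf]

theorem IsShuffleHom.of_conv_eq_zero {f k : List A → R} (hf : IsShuffleHom f)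
    (hf₁ : f [] = 1) (hk₁ : k [] = 1) (h : ∀ w, w ≠ [] → Stmt17.conv f k w = 0) :
    IsShuffleHom k
  | [], v => by simp [hk₁]
  | a :: u, [] => by simp [hk₁]
  | a :: u, b :: v => by
    have key : shuffleSum (a :: u) (b :: v) (Stmt17.conv f k) =
        Stmt17.conv f k (a :: u) * Stmt17.conv f k (b :: v) := by
      rw [shuffleSum_eq_zero a b u v h, h _ (List.cons_ne_nil a u), zero_mul]
    rw [shuffleSum_conv hf, conv_mul_conv] at key
    simp only [splitSum_cons _ a, splitSum_cons _ b] at key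
    have right : splitSum (fun x y => f [] * f (b :: x) * (k (a :: u) * k y)) v =
        splitSum (fun x y => f [] * f (b :: x) * shuffleSum (a :: u) y k) v :=
      splitSum_congr fun x y hxy => by
        have : y.length ≤ v.length := by simp [← hxy]
        rw [of_conv_eq_zero hf hf₁ hk₁ h (a :: u) y]
    have left : splitSum (fun x y => f (a :: x) * f [] * (k y * k (b :: v)) +
          splitSum (fun x' y' => f (a :: x) * f (b :: x') * (k y * k y')) v) u =
        splitSum (fun x y => f (a :: x) * f [] * shuffleSum y (b :: v) k +
          splitSum (fun x' y' => f (a :: x) * f (b :: x') * shuffleSum y y' k) v) u :=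
      splitSum_congr fun x y hxy => by
        have : y.length ≤ u.length := by simp [← hxy]
        rw [of_conv_eq_zero hf hf₁ hk₁ h y (b :: v)]
        congr 1
        refine splitSum_congr fun x' y' hxy' => ?_
        have : y'.length ≤ v.length := by simp [← hxy']
        rw [of_conv_eq_zero hf hf₁ hk₁ h y y']
    rw [left, right] at key
    simpa [hf₁] using key.symm
  termination_by u v => u.length + v.length
  decreasing_by all_goals simp only [List.length_cons]; omega

/-- Right inverses for the deconcatenation product are unique. -/
theorem eq_of_conv_eq_zero {f k k' : List A → R} (hf₁ : f [] = 1) (hk : k [] = k' [])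
    (h : ∀ w, w ≠ [] → conv f k w = 0) (h' : ∀ w, w ≠ [] → conv f k' w = 0) :
    ∀ w, k w = k' w
  | [] => hk
  | a :: w => by
    have key := (h _ (List.cons_ne_nil a w)).trans (h' _ (List.cons_ne_nil a w)).symm
    rw [conv_cons, conv_cons] at key
    have tail : conv (fun x => f (a :: x)) k w = conv (fun x => f (a :: x)) k' w :=
      splitSum_congr fun x y hxy => by
        have : y.length ≤ w.length := by simp [← hxy]
        rw [eq_of_conv_eq_zero hf₁ hk h h' y]
    simpa [tail, hf₁] using key
  termination_by w => w.length
  decreasing_by simp only [List.length_cons]; omega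

theorem IsMDS.apply_neg {X : List A → ℤ → ℤ → R} (hX : IsMDS X) {p q : ℤ}
    (h : Int.gcd p q = 1) : (X · p (-q)) = (X · (-p) q) := by
  funext w
  rcases eq_or_ne w [] with rfl | hw
  · simp [hX.1]
  · exact hX.2.1 w hw p q h

theorem IsMDS.apply_add {X : List A → ℤ → ℤ → R} (hX : IsMDS X) {p q : ℤ}
    (h : Int.gcd p q = 1) : (X · p q) = (X · p (p + q)) := by
  funext w
  rcases eq_or_ne w [] with rfl | hw
  · simp [hX.1]
  · exact hX.2.2 w hw p q h

end CommRing

/-- for shuffled componentwise `R`-valued multiple Dedekind symbols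
`(D^w)` and `(E^w)`:
(i) the inverse family `(K^w)` (with `K^∅ ≡ 1` and `Σ_{w=uv} D^u(p,q)·K^v(p,q) = 0` for
nonempty `w`) is a shuffled componentwise multiple Dedekind symbol;
(ii) the product family `H^w(p,q) = Σ_{w=uv} D^u(p,q)·E^v(p,q)` is a shuffled
componentwise multiple Dedekind symbol. -/
theorem inverse_and_product_shuffled {R : Type*} [CommRing R] {A : Type*}
    (D E : List A → ℤ → ℤ → R)
    (hD : IsMDS D) (hDsh : Shuffled D)
    (hE : IsMDS E) (hEsh : Shuffled E) :
    (∀ K : List A → ℤ → ℤ → R,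
      (∀ p q : ℤ, K [] p q = 1) →
      (∀ w : List A, w ≠ [] → ∀ p q : ℤ, Int.gcd p q = 1 →
        ∑ i ∈ Finset.range (w.length + 1), D (w.take i) p q * K (w.drop i) p q = 0) →
      (IsMDS K ∧ Shuffled K)) ∧
    (∀ H : List A → ℤ → ℤ → R,
      (∀ w : List A, ∀ p q : ℤ, H w p q =
        ∑ i ∈ Finset.range (w.length + 1), D (w.take i) p q * E (w.drop i) p q) →
      (IsMDS H ∧ Shuffled H)) := by
  refine ⟨fun K hK₁ hK => ?_, fun H hH => ?_⟩
  · have hconv : ∀ p q, Int.gcd p q = 1 → ∀ w, w ≠ [] → conv (D · p q) (K · p q) w = 0 :=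
      fun p q h w hw => hK w hw p q h
    refine ⟨⟨hK₁, fun w _ p q h => ?_, fun w _ p q h => ?_⟩, fun u v p q h => ?_⟩
    · have h' := hconv p (-q) (by simpa using h)
      rw [hD.apply_neg h] at h'
      exact eq_of_conv_eq_zero (hD.1 _ _) (by simp [hK₁]) h' (hconv (-p) q (by simpa using h)) w
    · have h' := hconv p q h
      rw [hD.apply_add h] at h'
      exact eq_of_conv_eq_zero (hD.1 _ _) (by simp [hK₁]) h' (hconv p (p + q) (by simpa using h)) w
    · exact IsShuffleHom.of_conv_eq_zero (fun u v => hDsh u v p q h) (hD.1 p q) (hK₁ p q)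
        (hconv p q h) u v
  · have hconv : ∀ p q, (H · p q) = conv (D · p q) (E · p q) := fun p q => funext fun w => hH w p q
    refine ⟨⟨fun p q => by simp [hH, hD.1, hE.1], fun w _ p q h => ?_, fun w _ p q h => ?_⟩,
      fun u v p q h => ?_⟩
    · refine congrFun (?_ : (H · p (-q)) = (H · (-p) q)) w
      rw [hconv, hconv, hD.apply_neg h, hE.apply_neg h]
    · refine congrFun (?_ : (H · p q) = (H · p (p + q))) w
      rw [hconv, hconv, hD.apply_add h, hE.apply_add h]
    · have hom : IsShuffleHom (H · p q) := hconv p q ▸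
        IsShuffleHom.conv (fun u v => hDsh u v p q h) (fun u v => hEsh u v p q h)
      exact hom u v

end Stmt17
end
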